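/- If a convex body K in ℝⁿ is a k-fold translative tile for some positive integer k, then K is a centrally symmetric polytope and all of its facets are centrally symmetric. -/

import Mathlib

open Pointwise

/-- A convex body in ℝⁿ: a compact convex set with nonempty interior. -/
def IsConvexBody {n : ℕ} (K : Set (EuclideanSpace ℝ (Fin n))) : Prop :=
  IsCompact K ∧ Convex ℝ K ∧ (interior K).Nonempty

/-- `K` is a `k`-fold translative tile: there is a (locally finite) multiset of translation
vectors, encoded as a family `x : ι → ℝⁿ`, such that every point of `ℝⁿ` not on the boundary
of any translate lies in exactly `k` translates, counted with multiplicity. -/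
def IsKFoldTranslativeTile {n : ℕ} (K : Set (EuclideanSpace ℝ (Fin n))) (k : ℕ) : Prop :=
  ∃ (ι : Type) (x : ι → EuclideanSpace ℝ (Fin n)),
    (∀ B : Set (EuclideanSpace ℝ (Fin n)), Bornology.IsBounded B →
        {i | ((x i +ᵥ K) ∩ B).Nonempty}.Finite) ∧
    ∀ p : EuclideanSpace ℝ (Fin n),
      (∀ i, p ∉ frontier (x i +ᵥ K)) → {i | p ∈ x i +ᵥ K}.encard = k

/-- `S` is centrally symmetric: `S = 2c − S` for some `c`. -/
def IsCentrallySymmetric {n : ℕ} (S : Set (EuclideanSpace ℝ (Fin n))) : Prop :=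
  ∃ c : EuclideanSpace ℝ (Fin n), (fun y => (2 : ℝ) • c - y) '' S = S

/-- `P` is a polytope: the convex hull of a finite set. -/
def IsPolytope {n : ℕ} (P : Set (EuclideanSpace ℝ (Fin n))) : Prop :=
  ∃ V : Finset (EuclideanSpace ℝ (Fin n)), P = convexHull ℝ (V : Set _)

/-- `F` is a nonempty exposed face of `P` of dimension `d`. -/
def IsFaceOfDim {n : ℕ} (P F : Set (EuclideanSpace ℝ (Fin n))) (d : ℕ) : Prop :=
  IsExposed ℝ P F ∧ F.Nonempty ∧ Module.finrank ℝ (affineSpan ℝ F).direction = d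

/-- The belt of `P` determined by a subfacet `G`: the facets of `P` containing a
translate of `G`. -/
def belt {n : ℕ} (P G : Set (EuclideanSpace ℝ (Fin n))) : Set (Set (EuclideanSpace ℝ (Fin n))) :=
  {F | IsFaceOfDim P F (n - 1) ∧ ∃ t : EuclideanSpace ℝ (Fin n), t +ᵥ G ⊆ F}

open MeasureTheory Set Filter Topology
open scoped ENNReal InnerProductSpace

section

/-- One-dimensional Brunn–Minkowski inequality for midpoints. -/
lemma volume_add_volume_le_two_mul_of_midpoint {A B C : Set ℝ} (hA : MeasurableSet A)
    (hB : MeasurableSet B) (hA' : A.Nonempty) (hB' : B.Nonempty)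
    (h : ∀ a ∈ A, ∀ b ∈ B, (2⁻¹ : ℝ) • (a + b) ∈ C) :
    volume A + volume B ≤ 2 * volume C := by
  have key : ∀ K ⊆ A, IsCompact K → K.Nonempty → ∀ L ⊆ B, IsCompact L → L.Nonempty →
      volume K + volume L ≤ 2 * volume C := by
    intro K hK hKc hKn L hL hLc hLn
    obtain ⟨a, ha, ha'⟩ := hKc.exists_isGreatest hKn
    obtain ⟨b, hb, hb'⟩ := hLc.exists_isLeast hLn
    have h1 : (2⁻¹ : ℝ) • (b +ᵥ K) ∪ (2⁻¹ : ℝ) • (a +ᵥ L) ⊆ C := by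
      rintro x (hx | hx)
      · obtain ⟨_, ⟨y, hy, rfl⟩, rfl⟩ := hx
        have := h y (hK hy) b (hL hb)
        simpa [add_comm] using this
      · obtain ⟨_, ⟨y, hy, rfl⟩, rfl⟩ := hx
        simpa using h a (hK ha) y (hL hy)
    have h2 : AEDisjoint volume ((2⁻¹ : ℝ) • (b +ᵥ K)) ((2⁻¹ : ℝ) • (a +ᵥ L)) := by
      refine measure_mono_null (t := {(2⁻¹ : ℝ) • (a + b)}) ?_ (by simp)
      rintro x ⟨⟨_, ⟨y, hy, rfl⟩, rfl⟩, ⟨_, ⟨z, hz, rfl⟩, hx⟩⟩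
      have e1 := ha' hy
      have e2 := hb' hz
      simp only [vadd_eq_add, smul_eq_mul, mem_singleton_iff] at *
      linarith
    have h3 := measure_mono (μ := volume) h1
    rw [measure_union₀ ((hLc.vadd a).smul (2⁻¹ : ℝ)).measurableSet.nullMeasurableSet h2,
      Measure.addHaar_smul, Measure.addHaar_smul, measure_vadd, measure_vadd, ← mul_add] at h3
    calc volume K + volume L = 2 * (2⁻¹ * (volume K + volume L)) := by
          rw [← mul_assoc, ENNReal.mul_inv_cancel (by simp) (by simp), one_mul]
      _ ≤ 2 * volume C := by
          gcongr
          refine le_trans (le_of_eq ?_) h3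
          congr 1
          simp [abs_of_pos]
  obtain ⟨a, ha⟩ := hA'
  obtain ⟨b, hb⟩ := hB'
  rw [hA.measure_eq_iSup_isCompact, hB.measure_eq_iSup_isCompact]
  simp only [iSup_and']
  refine ENNReal.biSup_add_biSup_le' ⟨∅, by simp⟩ ⟨∅, by simp⟩ ?_
  rintro K ⟨hK, hKc⟩ L ⟨hL, hLc⟩
  refine le_trans ?_ (key (insert a K) (insert_subset ha hK) (hKc.insert a) (by simp)
    (insert b L) (insert_subset hb hL) (hLc.insert b) (by simp))
  gcongr <;> exact subset_insert _ _

lemma ENNReal.mul_le_sq_of_add_le_two_mul {p q r : ℝ≥0∞} (h : p + q ≤ 2 * r) :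
    p * q ≤ r ^ 2 := by
  rcases eq_or_ne r ⊤ with rfl | hr
  · simp
  have h2 : p + q ≠ ⊤ := ne_top_of_le_ne_top (ENNReal.mul_ne_top (by simp) hr) h
  obtain ⟨hp, hq⟩ := ENNReal.add_ne_top.1 h2
  lift p to NNReal using hp
  lift q to NNReal using hq
  lift r to NNReal using hr
  norm_cast at h ⊢
  have h' : (p : ℝ) + q ≤ 2 * r := by exact_mod_cast h
  have : (p : ℝ) * q ≤ r ^ 2 := by
    nlinarith [sq_nonneg ((p : ℝ) - q), p.2, q.2, r.2]
  exact_mod_cast this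

lemma measurable_measure_lt (f : ℝ → ℝ) : Measurable fun t => volume {x | t < f x} :=
  Antitone.measurable fun _ _ hst => measure_mono fun _ hx => lt_of_le_of_lt hst hx

lemma lintegral_add_lintegral_le_two_mul_of_midpoint {f g h : ℝ → ℝ} (hf : Measurable f)
    (hg : Measurable g) (hh : Measurable h) (hf0 : 0 ≤ f) (hg0 : 0 ≤ g) (hh0 : 0 ≤ h)
    (hf1 : ∀ x, f x ≤ 1) (hg1 : ∀ x, g x ≤ 1) (hf2 : ∀ t < 1, ∃ x, t < f x)
    (hg2 : ∀ t < 1, ∃ x, t < g x) (H : ∀ x y, f x * g y ≤ h ((2⁻¹ : ℝ) • (x + y)) ^ 2) :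
    (∫⁻ x, ENNReal.ofReal (f x)) + ∫⁻ x, ENNReal.ofReal (g x) ≤
      2 * ∫⁻ x, ENNReal.ofReal (h x) := by
  rw [lintegral_eq_lintegral_meas_lt _ (.of_forall hf0) hf.aemeasurable,
    lintegral_eq_lintegral_meas_lt _ (.of_forall hg0) hg.aemeasurable,
    lintegral_eq_lintegral_meas_lt _ (.of_forall hh0) hh.aemeasurable,
    ← lintegral_add_left', ← lintegral_const_mul'']
  · refine setLIntegral_mono' measurableSet_Ioi fun t ht => ?_
    rcases lt_or_ge t 1 with ht1 | ht1
    · refine volume_add_volume_le_two_mul_of_midpoint (measurableSet_lt measurable_const hf)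
        (measurableSet_lt measurable_const hg) (hf2 t ht1) (hg2 t ht1) ?_
      intro a ha b hb
      have ht : 0 < t := ht
      simp only [mem_ofPred_eq] at *
      refine lt_of_pow_lt_pow_left₀ 2 (hh0 _) ((lt_of_lt_of_le ?_ (H a b)))
      nlinarith
    · have e1 : {a | t < f a} = ∅ := by
        ext a; simpa using (hf1 a).trans ht1
      have e2 : {a | t < g a} = ∅ := by
        ext a; simpa using (hg1 a).trans ht1
      simp [e1, e2]
  · exact (measurable_measure_lt h).aemeasurable
  · exact (measurable_measure_lt f).aemeasurable

/-- The midpoint Prékopa–Leindler inequality on a measured real vector space. -/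
def PrekopaLeindler (E : Type*) [AddCommGroup E] [Module ℝ E] [MeasureSpace E] : Prop :=
  ∀ f g h : E → ℝ≥0∞, Measurable f → Measurable g → Measurable h →
    (∀ x y, f x * g y ≤ h ((2⁻¹ : ℝ) • (x + y)) ^ 2) →
    (∫⁻ x, f x) * (∫⁻ x, g x) ≤ (∫⁻ x, h x) ^ 2

lemma lintegral_eq_iSup_min {α : Type*} [MeasurableSpace α] (μ : Measure α) {f : α → ℝ≥0∞}
    (hf : Measurable f) : ∫⁻ x, f x ∂μ = ⨆ m : ℕ, ∫⁻ x, min (f x) m ∂μ := by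
  rw [← lintegral_iSup (fun m => hf.min measurable_const)
    (fun m n hmn x => min_le_min le_rfl (by exact_mod_cast hmn))]
  congr with x
  apply le_antisymm
  · refine le_of_forall_lt fun c hc => ?_
    obtain ⟨n, hn⟩ := ENNReal.exists_nat_gt hc.ne_top
    exact lt_of_lt_of_le (lt_min hc hn) (le_iSup (fun m : ℕ => min (f x) (m : ℝ≥0∞)) n)
  · exact iSup_le fun m => min_le_left _ _

lemma prekopaLeindler_real_of_bounded {f g h : ℝ → ℝ≥0∞} (hf : Measurable f) (hg : Measurable g)
    (hh : Measurable h) (hft : (⨆ x, f x) ≠ ⊤) (hgt : (⨆ x, g x) ≠ ⊤)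
    (H : ∀ x y, f x * g y ≤ h ((2⁻¹ : ℝ) • (x + y)) ^ 2) :
    (∫⁻ x, f x) * (∫⁻ x, g x) ≤ (∫⁻ x, h x) ^ 2 := by
  set a := ⨆ x, f x with ha
  set b := ⨆ x, g x with hb
  rcases eq_or_ne a 0 with ha0 | ha0
  · have : f = 0 := by
      ext x; exact le_antisymm ((le_iSup f x).trans ha0.le) bot_le
    simp [this]
  rcases eq_or_ne b 0 with hb0 | hb0
  · have : g = 0 := by
      ext x; exact le_antisymm ((le_iSup g x).trans hb0.le) bot_le
    simp [this]
  have hfa : ∀ x, f x ≤ a := le_iSup f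
  have hgb : ∀ x, g x ≤ b := le_iSup g
  set c := (a * b) ^ (2⁻¹ : ℝ) with hc
  have hab0 : a * b ≠ 0 := mul_ne_zero ha0 hb0
  have habt : a * b ≠ ⊤ := ENNReal.mul_ne_top hft hgt
  have hc2 : c ^ 2 = a * b := by
    rw [hc, ← ENNReal.rpow_natCast, ← ENNReal.rpow_mul]; norm_num
  have hc0 : c ≠ 0 := by rintro h0; simp [h0] at hc2; tauto
  have hct : c ≠ ⊤ := by rintro h0; rw [h0] at hc2; exact habt (by rw [← hc2]; simp)
  have hF1 : ∀ x, f x / a ≤ 1 := fun x => ENNReal.div_le_of_le_mul (by simpa using hfa x)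
  have hG1 : ∀ x, g x / b ≤ 1 := fun x => ENNReal.div_le_of_le_mul (by simpa using hgb x)
  have hFt : ∀ x, f x / a ≠ ⊤ := fun x => ne_top_of_le_ne_top (by simp) (hF1 x)
  have hGt : ∀ x, g x / b ≠ ⊤ := fun x => ne_top_of_le_ne_top (by simp) (hG1 x)
  have hHt : ∀ x, min (h x / c) 1 ≠ ⊤ := fun x => ne_top_of_le_ne_top (by simp) (min_le_right _ _)
  have hsup : ∀ (φ : ℝ → ℝ≥0∞) (s : ℝ≥0∞), s = ⨆ x, φ x → s ≠ 0 → s ≠ ⊤ →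
      (∀ x, φ x / s ≠ ⊤) → ∀ t < (1 : ℝ), ∃ x, t < (φ x / s).toReal := by
    intro φ s hs hs0 hst hφ t ht
    rcases lt_or_ge t 0 with ht0 | ht0
    · exact ⟨0, ht0.trans_le ENNReal.toReal_nonneg⟩
    have h1 : ENNReal.ofReal t * s < s := by
      conv_rhs => rw [← one_mul s]
      exact ENNReal.mul_lt_mul_left hs0 hst (by simpa using ht)
    rw [hs] at h1
    obtain ⟨x, hx⟩ := lt_iSup_iff.1 h1
    refine ⟨x, ?_⟩
    rw [← ENNReal.ofReal_lt_iff_lt_toReal ht0 (hφ x)]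
    rw [← hs] at hx
    rw [ENNReal.lt_div_iff_mul_lt (.inl hs0) (.inl hst)]
    exact hx
  have key := lintegral_add_lintegral_le_two_mul_of_midpoint
    (f := fun x => (f x / a).toReal) (g := fun x => (g x / b).toReal)
    (h := fun x => (min (h x / c) 1).toReal)
    (hf.div_const a).ennreal_toReal (hg.div_const b).ennreal_toReal
    ((hh.div_const c).min measurable_const).ennreal_toReal
    (fun x => ENNReal.toReal_nonneg) (fun x => ENNReal.toReal_nonneg)
    (fun x => ENNReal.toReal_nonneg)
    (fun x => ENNReal.toReal_le_of_le_ofReal zero_le_one (by simpa using hF1 x))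
    (fun x => ENNReal.toReal_le_of_le_ofReal zero_le_one (by simpa using hG1 x))
    (hsup f a ha ha0 hft hFt) (hsup g b hb hb0 hgt hGt) (by
      intro x y
      rw [← ENNReal.toReal_mul, ← ENNReal.toReal_pow]
      refine ENNReal.toReal_mono (ENNReal.pow_ne_top (hHt _)) ?_
      rcases min_cases (h ((2⁻¹ : ℝ) • (x + y)) / c) 1 with ⟨e, -⟩ | ⟨e, -⟩
      · rw [e, ENNReal.div_eq_inv_mul, ENNReal.div_eq_inv_mul, ENNReal.div_eq_inv_mul, mul_pow,
          ← ENNReal.inv_pow, hc2, ENNReal.mul_inv (.inl ha0) (.inl hft)]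
        calc a⁻¹ * f x * (b⁻¹ * g y) = a⁻¹ * b⁻¹ * (f x * g y) := by ring
          _ ≤ _ := by gcongr; exact H x y
      · rw [e, one_pow]
        exact mul_le_one' (hF1 x) (hG1 y))
  simp only [ENNReal.ofReal_toReal, hFt, hGt, hHt, ne_eq, not_false_eq_true] at key
  have key2 := ENNReal.mul_le_sq_of_add_le_two_mul key
  have e1 : ∫⁻ x, f x / a = (∫⁻ x, f x) / a := by
    simp only [div_eq_mul_inv]; rw [lintegral_mul_const _ hf]
  have e2 : ∫⁻ x, g x / b = (∫⁻ x, g x) / b := by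
    simp only [div_eq_mul_inv]; rw [lintegral_mul_const _ hg]
  have e3 : ∫⁻ x, min (h x / c) 1 ≤ (∫⁻ x, h x) / c := by
    refine (lintegral_mono fun x => min_le_left _ _).trans ?_
    simp only [div_eq_mul_inv]; rw [lintegral_mul_const _ hh]
  rw [e1, e2] at key2
  calc (∫⁻ x, f x) * (∫⁻ x, g x) = a * b * ((∫⁻ x, f x) / a * ((∫⁻ x, g x) / b)) := by
        rw [mul_mul_mul_comm, ENNReal.mul_div_cancel ha0 hft, ENNReal.mul_div_cancel hb0 hgt]
    _ ≤ c ^ 2 * ((∫⁻ x, h x) / c) ^ 2 := by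
        rw [hc2]; gcongr; exact key2.trans (by gcongr)
    _ = _ := by rw [← mul_pow, ENNReal.mul_div_cancel hc0 hct]

lemma prekopaLeindler_real : PrekopaLeindler ℝ := by
  intro f g h hf hg hh H
  rw [lintegral_eq_iSup_min _ hf, lintegral_eq_iSup_min _ hg, ENNReal.iSup_mul]
  refine iSup_le fun m => ?_
  rw [ENNReal.mul_iSup]
  refine iSup_le fun m' => ?_
  refine prekopaLeindler_real_of_bounded (hf.min measurable_const) (hg.min measurable_const) hh
    ?_ ?_ fun x y => le_trans ?_ (H x y)
  · exact ne_top_of_le_ne_top (ENNReal.natCast_ne_top m) (iSup_le fun x => min_le_right _ _)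
  · exact ne_top_of_le_ne_top (ENNReal.natCast_ne_top m') (iSup_le fun x => min_le_right _ _)
  · gcongr <;> exact min_le_left _ _

lemma PrekopaLeindler.prod {E F : Type*} [AddCommGroup E] [Module ℝ E] [MeasureSpace E]
    [AddCommGroup F] [Module ℝ F] [MeasureSpace F] [SFinite (volume : Measure F)]
    (hE : PrekopaLeindler E) (hF : PrekopaLeindler F) [SFinite (volume : Measure E)] :
    PrekopaLeindler (E × F) := by
  intro f g h hf hg hh H
  rw [Measure.volume_eq_prod, lintegral_prod _ hf.aemeasurable, lintegral_prod _ hg.aemeasurable,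
    lintegral_prod _ hh.aemeasurable]
  refine hE _ _ _ hf.lintegral_prod_right' hg.lintegral_prod_right' hh.lintegral_prod_right' ?_
  intro x x'
  refine hF _ _ _ (hf.comp measurable_prodMk_left) (hg.comp measurable_prodMk_left)
    (hh.comp measurable_prodMk_left) ?_
  intro y y'
  exact H (x, y) (x', y')

lemma PrekopaLeindler.of_measurePreserving {E F : Type*} [AddCommGroup E] [Module ℝ E]
    [MeasureSpace E] [AddCommGroup F] [Module ℝ F] [MeasureSpace F] (hE : PrekopaLeindler E)
    (e : E ≃ᵐ F) (he : MeasurePreserving e)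
    (he' : ∀ x y, e ((2⁻¹ : ℝ) • (x + y)) = (2⁻¹ : ℝ) • (e x + e y)) : PrekopaLeindler F := by
  intro f g h hf hg hh H
  rw [← he.lintegral_comp hf, ← he.lintegral_comp hg, ← he.lintegral_comp hh]
  refine hE _ _ _ (hf.comp e.measurable) (hg.comp e.measurable) (hh.comp e.measurable) ?_
  intro x y
  rw [he']
  exact H _ _

lemma prekopaLeindler_pi : ∀ n : ℕ, PrekopaLeindler (Fin n → ℝ)
  | 0 => by
    intro f g h hf hg hh H
    have : (volume : Measure (Fin 0 → ℝ)) = Measure.dirac 0 := by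
      rw [volume_pi, Measure.pi_of_empty _ 0]
    rw [this, lintegral_dirac, lintegral_dirac, lintegral_dirac]
    simpa using H 0 0
  | n + 1 => by
    refine (prekopaLeindler_real.prod (prekopaLeindler_pi n)).of_measurePreserving
      (MeasurableEquiv.piFinSuccAbove (fun _ => ℝ) 0).symm
      ((volume_preserving_piFinSuccAbove (fun _ => ℝ) 0).symm) ?_
    intro x y
    rw [MeasurableEquiv.symm_apply_eq]
    ext <;> simp [MeasurableEquiv.piFinSuccAbove, Fin.insertNthEquiv, Fin.tail]

variable (E : Type*) [NormedAddCommGroup E] [InnerProductSpace ℝ E] [FiniteDimensional ℝ E]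
    [MeasurableSpace E] [BorelSpace E]

theorem prekopaLeindler : PrekopaLeindler E := by
  have h1 : PrekopaLeindler (EuclideanSpace ℝ (Fin (Module.finrank ℝ E))) :=
    (prekopaLeindler_pi _).of_measurePreserving (MeasurableEquiv.toLp 2 _)
      ((EuclideanSpace.volume_preserving_symm_measurableEquiv_toLp _).symm) fun x y => rfl
  exact h1.of_measurePreserving (stdOrthonormalBasis ℝ E).repr.symm.toMeasurableEquiv
    (stdOrthonormalBasis ℝ E).repr.symm.measurePreserving fun x y => by
      simp

end

section

variable {E : Type*} [NormedAddCommGroup E] [InnerProductSpace ℝ E] [FiniteDimensional ℝ E]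
    [MeasurableSpace E] [BorelSpace E]

lemma lintegral_indicator_ofReal_eq_ofReal_setIntegral {S : Set E} (hS : IsCompact S) {q : E → ℝ}
    (hq : Continuous q) (hq0 : ∀ x ∈ S, 0 ≤ q x) :
    ∫⁻ x, S.indicator (fun x => ENNReal.ofReal (q x)) x = ENNReal.ofReal (∫ x in S, q x) := by
  rw [lintegral_indicator hS.measurableSet, ofReal_integral_eq_lintegral_ofReal
    (hq.continuousOn.integrableOn_compact hS) (ae_restrict_of_forall_mem hS.measurableSet hq0)]

/-- The midpoint Prékopa–Leindler inequality for continuous functions on compact sets. -/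
lemma setIntegral_mul_setIntegral_le_sq {A B D : Set E} (hA : IsCompact A) (hB : IsCompact B)
    (hD : IsCompact D) (hABD : ∀ x ∈ A, ∀ y ∈ B, (2⁻¹ : ℝ) • (x + y) ∈ D) {f g h : E → ℝ}
    (hf : Continuous f) (hg : Continuous g) (hh : Continuous h) (hf0 : ∀ x ∈ A, 0 ≤ f x)
    (hg0 : ∀ x ∈ B, 0 ≤ g x) (hh0 : ∀ x ∈ D, 0 ≤ h x)
    (H : ∀ x ∈ A, ∀ y ∈ B, f x * g y ≤ h ((2⁻¹ : ℝ) • (x + y)) ^ 2) :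
    (∫ x in A, f x) * (∫ x in B, g x) ≤ (∫ x in D, h x) ^ 2 := by
  have key := prekopaLeindler E (A.indicator fun x => ENNReal.ofReal (f x))
    (B.indicator fun x => ENNReal.ofReal (g x)) (D.indicator fun x => ENNReal.ofReal (h x))
    (hf.measurable.ennreal_ofReal.indicator hA.measurableSet)
    (hg.measurable.ennreal_ofReal.indicator hB.measurableSet)
    (hh.measurable.ennreal_ofReal.indicator hD.measurableSet) (by
      intro x y
      by_cases hx : x ∈ A
      · by_cases hy : y ∈ B
        · rw [indicator_of_mem hx, indicator_of_mem hy, indicator_of_mem (hABD x hx y hy),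
            ← ENNReal.ofReal_mul (hf0 x hx), ← ENNReal.ofReal_pow (hh0 _ (hABD x hx y hy))]
          exact ENNReal.ofReal_le_ofReal (H x hx y hy)
        · simp [hy]
      · simp [hx])
  have hD0 : 0 ≤ ∫ x in D, h x := setIntegral_nonneg hD.measurableSet hh0
  rw [lintegral_indicator_ofReal_eq_ofReal_setIntegral hA hf hf0,
    lintegral_indicator_ofReal_eq_ofReal_setIntegral hB hg hg0,
    lintegral_indicator_ofReal_eq_ofReal_setIntegral hD hh hh0,
    ← ENNReal.ofReal_mul (setIntegral_nonneg hA.measurableSet hf0),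
    ← ENNReal.ofReal_pow hD0, ENNReal.ofReal_le_ofReal_iff (sq_nonneg _)] at key
  exact key

lemma setIntegral_neg_eq {A : Set E} (f : E → ℝ) : ∫ x in -A, f x = ∫ x in A, f (-x) := by
  have := (Measure.measurePreserving_neg (volume : Measure E)).setIntegral_preimage_emb
    (MeasurableEquiv.neg E).measurableEmbedding (fun x => f (-x)) A
  simpa using this

lemma perturbed_product_le_sq {s t b δ p : ℝ} (hs : -2⁻¹ ≤ s ∧ s ≤ 2⁻¹) (ht : -2⁻¹ ≤ t ∧ t ≤ 2⁻¹)
    (htb : t ≤ b) (hp : 0 ≤ p) (hp' : p = s - b ∨ p = 0) :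
    (1 + s) * (1 + δ * p) * (1 + t) ≤ (1 + 2⁻¹ * (s + t) + 6 * δ ^ 2) ^ 2 := by
  have hst : (1 + s) * (1 + t) = (1 + 2⁻¹ * (s + t)) ^ 2 - (s - t) ^ 2 / 4 := by ring
  have hpst : p ^ 2 ≤ (s - t) ^ 2 := by
    rcases hp' with h | h
    · exact pow_le_pow_left₀ hp (by linarith) 2
    · rw [h]
      nlinarith [sq_nonneg (s - t)]
  have hq : 2⁻¹ ≤ 1 + 2⁻¹ * (s + t) := by linarith
  have hq2 : 1 + 2⁻¹ * (s + t) ≤ 3 / 2 := by linarith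
  have hw : (1 + 2⁻¹ * (s + t)) ^ 2 ≤ 9 / 4 := by nlinarith
  have hw0 : 0 ≤ (1 + s) * (1 + t) := mul_nonneg (by linarith) (by linarith)
  have hprod : (1 + s) * (1 + t) * (δ * p) ≤ 81 / 16 * δ ^ 2 + p ^ 2 / 4 := by
    have h1 : (1 + s) * (1 + t) ≤ 9 / 4 := by linarith [sq_nonneg (s - t)]
    have h2 : (1 + s) * (1 + t) * (δ * p) ≤ 9 / 4 * |δ * p| :=
      (mul_le_mul_of_nonneg_left (le_abs_self _) hw0).trans
        (mul_le_mul_of_nonneg_right h1 (abs_nonneg _))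
    have h3 : 9 / 4 * |δ * p| ≤ 81 / 16 * δ ^ 2 + p ^ 2 / 4 := by
      rcases abs_cases (δ * p) with ⟨h, -⟩ | ⟨h, -⟩ <;> rw [h] <;>
        nlinarith [sq_nonneg (9 / 2 * δ - p), sq_nonneg (9 / 2 * δ + p)]
    exact h2.trans h3
  have hR : (1 + 2⁻¹ * (s + t)) ^ 2 + 6 * δ ^ 2 ≤ (1 + 2⁻¹ * (s + t) + 6 * δ ^ 2) ^ 2 := by
    nlinarith [mul_le_mul_of_nonneg_right hq (sq_nonneg δ), sq_nonneg (δ ^ 2)]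
  nlinarith [sq_nonneg δ]

lemma subset_neg_of_centroid_eq_zero {A : Set E} (hA : IsCompact A) (hAc : Convex ℝ A)
    (hAi : (interior A).Nonempty) (hvol : volume ((2⁻¹ : ℝ) • (A - A)) ≤ volume A)
    (hcent : ∀ l : E →L[ℝ] ℝ, ∫ x in A, l x = 0) : A ⊆ -A := by
  by_contra hsub
  obtain ⟨x₀, hx₀, hx₀'⟩ := not_subset.1 hsub
  obtain ⟨l₀, u, hu, hux⟩ := geometric_hahn_banach_closed_point hAc.neg hA.neg.isClosed hx₀'
  obtain ⟨M, hM⟩ := hA.exists_bound_of_continuousOn l₀.continuous.continuousOn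
  have hM0 : 0 ≤ M := (norm_nonneg _).trans (hM x₀ hx₀)
  set c : ℝ := (2 * (M + 1))⁻¹ with hc
  have hc0 : 0 < c := by positivity
  set l : E →L[ℝ] ℝ := c • l₀ with hl
  set b : ℝ := c * u with hb
  have hlA : ∀ x ∈ A, |l x| ≤ 2⁻¹ := by
    intro x hx
    have := hM x hx
    rw [Real.norm_eq_abs] at this
    simp only [hl, smul_apply, smul_eq_mul, abs_mul, abs_of_pos hc0]
    calc c * |l₀ x| ≤ c * (M + 1) := by gcongr; linarith
      _ = 2⁻¹ := by rw [hc]; field_simp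
  have hlb : ∀ y ∈ -A, l y ≤ b := fun y hy => by
    simp only [hl, hb, smul_apply, smul_eq_mul]
    exact mul_le_mul_of_nonneg_left (hu y hy).le hc0.le
  have hlx : b < l x₀ := by
    simp only [hl, hb, smul_apply, smul_eq_mul]
    exact mul_lt_mul_of_pos_left hux hc0
  have hlA' : ∀ y ∈ -A, |l y| ≤ 2⁻¹ := fun y hy => by
    have := hlA (-y) hy
    rwa [map_neg, abs_neg] at this
  set ψ : E → ℝ := fun x => max (l x - b) 0 with hψ
  have hψc : Continuous ψ := by fun_prop
  set D : Set E := (2⁻¹ : ℝ) • (A - A) with hD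
  have hDcomp : IsCompact D := by
    rw [hD, sub_eq_add_neg]; exact (hA.add hA.neg).smul _
  have hmid : ∀ x ∈ A, ∀ y ∈ -A, (2⁻¹ : ℝ) • (x + y) ∈ D := fun x hx y hy =>
    smul_mem_smul_set ⟨x, hx, -y, hy, by simp⟩
  have hlD : ∀ x ∈ D, |l x| ≤ 2⁻¹ := by
    rintro _ ⟨_, ⟨x, hx, y, hy, rfl⟩, rfl⟩
    have h1 := abs_le.1 (hlA x hx)
    have h2 := abs_le.1 (hlA y hy)
    simp only [map_smul, map_sub, smul_eq_mul]
    rw [abs_le]; constructor <;> linarith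
  have hDneg : -D = D := by
    rw [hD, ← smul_set_neg, neg_sub]
  have hlDint : ∫ x in D, l x = 0 := by
    have := setIntegral_neg_eq (A := D) l
    simp only [hDneg, map_neg, integral_neg] at this
    linarith
  have hlA'int : ∫ x in -A, l x = 0 := by
    have := setIntegral_neg_eq (A := A) l
    simpa [integral_neg, hcent l] using this
  set v := volume.real A with hv
  have hAfin : volume A ≠ ⊤ := hA.measure_ne_top
  have hvD : volume.real D ≤ v := ENNReal.toReal_mono hAfin hvol
  have hvA' : volume.real (-A) = v := by simp [hv, measureReal_def]
  have hv0 : 0 < v := by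
    rw [hv, measureReal_def, ENNReal.toReal_pos_iff]
    exact ⟨(isOpen_interior.measure_pos _ hAi).trans_le (measure_mono interior_subset),
      hAfin.lt_top⟩
  set α := ∫ x in A, (1 + l x) * ψ x with hα
  have int : ∀ (S : Set E), IsCompact S → ∀ f : E → ℝ, Continuous f → IntegrableOn f S :=
    fun S hS f hf => hf.continuousOn.integrableOn_compact hS
  have hα0 : 0 < α := by
    rw [hα, setIntegral_pos_iff_support_of_nonneg_ae]
    · have hopen : IsOpen ({x | 0 < l x - b} ∩ interior A) :=
        (isOpen_lt continuous_const (by fun_prop)).inter isOpen_interior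
      refine (hopen.measure_pos volume ?_).trans_le (measure_mono ?_)
      · have hcl : x₀ ∈ closure (interior A) := by
          rw [hAc.closure_interior_eq_closure_of_nonempty_interior hAi]
          exact subset_closure hx₀
        exact mem_closure_iff.1 hcl {x | 0 < l x - b} (isOpen_lt continuous_const (by fun_prop))
          (by simpa using hlx)
      · rintro x ⟨hx1, hx2⟩
        have hxA := interior_subset hx2
        refine ⟨?_, hxA⟩
        have h1 := abs_le.1 (hlA x hxA)
        have hx1 : 0 < l x - b := hx1
        have : 0 < (1 + l x) * ψ x := mul_pos (by linarith) (lt_max_of_lt_left hx1)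
        exact this.ne'
    · refine ae_restrict_of_forall_mem hA.measurableSet fun x hx => ?_
      have h1 := abs_le.1 (hlA x hx)
      exact mul_nonneg (by linarith) (le_max_right _ _)
    · exact int A hA _ (by fun_prop)
  have key : ∀ δ : ℝ, 0 < δ → δ ≤ 1 → α ≤ 48 * v * δ := by
    intro δ hδ hδ1
    have h1 := setIntegral_mul_setIntegral_le_sq hA hA.neg hDcomp hmid
      (f := fun x => (1 + l x) * (1 + δ * ψ x)) (g := fun x => 1 + l x)
      (h := fun x => 1 + l x + 6 * δ ^ 2) (by fun_prop) (by fun_prop) (by fun_prop)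
      (fun x hx => by
        have h1 := abs_le.1 (hlA x hx)
        exact mul_nonneg (by linarith) (by positivity))
      (fun x hx => by have h1 := abs_le.1 (hlA' x hx); linarith)
      (fun x hx => by have h1 := abs_le.1 (hlD x hx); nlinarith [sq_nonneg δ])
      (fun x hx y hy => by
        have h1 := abs_le.1 (hlA x hx)
        have h2 := abs_le.1 (hlA' y hy)
        have h3 := hlb y hy
        have hψ0 : 0 ≤ ψ x := le_max_right _ _
        have e : l ((2⁻¹ : ℝ) • (x + y)) = 2⁻¹ * (l x + l y) := by simp [mul_add]
        simp only [e]
        exact perturbed_product_le_sq h1 h2 h3 hψ0 (max_choice _ _))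
    have e1 : ∫ x in A, (1 + l x) * (1 + δ * ψ x) = v + δ * α := by
      have : ∀ x, (1 + l x) * (1 + δ * ψ x) = 1 + l x + δ * ((1 + l x) * ψ x) := fun x => by ring
      simp only [this]
      rw [integral_add (int A hA _ (by fun_prop)) (int A hA _ (by fun_prop)),
        integral_add (int A hA _ (by fun_prop)) (int A hA _ (by fun_prop)), hcent l,
        integral_const_mul, ← hα]
      simp [hv]
    have e2 : ∫ x in -A, (1 + l x) = v := by
      rw [integral_add (int _ hA.neg _ (by fun_prop)) (int _ hA.neg _ (by fun_prop)), hlA'int]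
      simp [hvA']
    have e3 : ∫ x in D, (1 + l x + 6 * δ ^ 2) = volume.real D * (1 + 6 * δ ^ 2) := by
      rw [integral_add (int _ hDcomp _ (by fun_prop)) (int _ hDcomp _ (by fun_prop)),
        integral_add (int _ hDcomp _ (by fun_prop)) (int _ hDcomp _ (by fun_prop)), hlDint]
      simp
      ring
    rw [e1, e2, e3] at h1
    have h2 : (volume.real D * (1 + 6 * δ ^ 2)) ^ 2 ≤ (v * (1 + 6 * δ ^ 2)) ^ 2 := by
      gcongr
    have h3 : v * (δ * α) ≤ v * (δ * (48 * v * δ)) := by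
      have h4 : δ ^ 4 ≤ δ ^ 2 := pow_le_pow_of_le_one hδ.le hδ1 (by norm_num)
      nlinarith [mul_le_mul_of_nonneg_left h4 (sq_nonneg v)]
    exact le_of_mul_le_mul_left (le_of_mul_le_mul_left h3 hv0) hδ
  have hδ0 : 0 < min 1 (α / (96 * v)) := by positivity
  have h1 := key _ hδ0 (min_le_left _ _)
  have h2 : 48 * v * min 1 (α / (96 * v)) ≤ 48 * v * (α / (96 * v)) := by
    gcongr; exact min_le_right _ _
  have h3 : 48 * v * (α / (96 * v)) = α / 2 := by field_simp; norm_num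
  linarith

/-- Equality in the Brunn–Minkowski inequality for `A` and `-A` forces central symmetry. -/
lemma exists_center_of_volume_midpoint_le {A : Set E} (hA : IsCompact A) (hAc : Convex ℝ A)
    (hAi : (interior A).Nonempty) (hvol : volume ((2⁻¹ : ℝ) • (A - A)) ≤ volume A) :
    ∃ c : E, (fun y => (2 : ℝ) • c - y) '' A = A := by
  set v := volume.real A with hv
  have hv0 : v ≠ 0 := by
    rw [hv, measureReal_def, ENNReal.toReal_ne_zero]
    exact ⟨((isOpen_interior.measure_pos _ hAi).trans_le (measure_mono interior_subset)).ne',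
      hA.measure_ne_top⟩
  set c : E := v⁻¹ • ∫ x in A, x with hc
  set A' : Set E := (fun x => x + c) ⁻¹' A with hA'
  have hA'e : A' = -c +ᵥ A := by
    ext x; rw [hA', mem_vadd_set_iff_neg_vadd_mem]; simp [add_comm]
  have hsub : A' ⊆ -A' := by
    refine subset_neg_of_centroid_eq_zero ?_ ?_ ?_ ?_ ?_
    · rw [hA'e]; exact hA.vadd _
    · rw [hA'e]; exact hAc.vadd _
    · rw [hA'e, interior_vadd]; exact hAi.vadd_set
    · have : A' - A' = A - A := by
        ext x
        constructor
        · rintro ⟨a, ha, b, hb, rfl⟩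
          exact ⟨a + c, ha, b + c, hb, by simp⟩
        · rintro ⟨a, ha, b, hb, rfl⟩
          exact ⟨a - c, by simpa [hA'] using ha, b - c, by simpa [hA'] using hb, by simp⟩
      rw [this, hA'e, measure_vadd]
      exact hvol
    · intro l
      have := (measurePreserving_add_right (volume : Measure E) c).setIntegral_preimage_emb
        (measurableEmbedding_addRight c) (fun y => l (y - c)) A
      simp only [add_sub_cancel_right] at this
      rw [hA', this]
      have hid : IntegrableOn (fun x : E => x) A :=
        continuous_id.continuousOn.integrableOn_compact hA
      simp only [map_sub]
      rw [integral_sub (l.continuous.continuousOn.integrableOn_compact hA)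
          (continuous_const.continuousOn.integrableOn_compact hA),
        l.integral_comp_comm hid]
      simp only [hc, integral_const, map_smul, smul_eq_mul, measureReal_restrict_apply_univ, ← hv]
      field_simp
      simp
  refine ⟨c, subset_antisymm ?_ ?_⟩
  · rintro _ ⟨y, hy, rfl⟩
    have : -(y - c) ∈ A' := hsub (by simpa [hA'] using hy)
    have h2 : -(y - c) + c ∈ A := this
    convert h2 using 1
    module
  · intro y hy
    have : -(y - c) ∈ A' := hsub (by simpa [hA'] using hy)
    have h2 : -(y - c) + c ∈ A := this
    refine ⟨_, h2, ?_⟩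
    change (2 : ℝ) • c - (-(y - c) + c) = y
    module

end

section

variable {E : Type*} [NormedAddCommGroup E] [InnerProductSpace ℝ E] [FiniteDimensional ℝ E]
    [MeasurableSpace E] [BorelSpace E]

lemma volumeReal_smul_add_smul_neg_le_sq {A : Set E} (hA : IsCompact A) (hAc : Convex ℝ A) {s : ℝ}
    (hs1 : s ≤ 1) :
    volume.real A * volume.real ((1 - s) • A + s • (-A)) ≤
      volume.real ((1 - s / 2) • A + (s / 2) • (-A)) ^ 2 := by
  have hD : ∀ r : ℝ, IsCompact ((1 - r) • A + r • (-A)) := fun r =>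
    (hA.smul _).add (hA.neg.smul _)
  have := setIntegral_mul_setIntegral_le_sq hA (hD s) (hD (s / 2)) (f := fun _ => 1)
    (g := fun _ => 1) (h := fun _ => 1) ?_ continuous_const continuous_const continuous_const
    (by simp) (by simp) (by simp) (by simp)
  · simpa using this
  · rintro a ha _ ⟨_, ⟨b, hb, rfl⟩, _, ⟨c, hc, rfl⟩, rfl⟩
    have hpos : 0 < 1 - s / 2 := by linarith
    refine ⟨_, ⟨(1 - s / 2)⁻¹ • ((1 / 2 : ℝ) • a + ((1 - s) / 2) • b), ?_, rfl⟩, _,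
      ⟨c, hc, rfl⟩, ?_⟩
    · rw [smul_add, smul_smul, smul_smul]
      refine hAc ha hb (by positivity) (mul_nonneg (by positivity) (by linarith)) ?_
      rw [← mul_add, inv_mul_eq_one₀ hpos.ne']; ring
    · simp only
      rw [smul_inv_smul₀ hpos.ne']
      module

lemma volume_midpoint_le_of_first_order {A : Set E} (hA : IsCompact A) (hAc : Convex ℝ A)
    (hAi : (interior A).Nonempty)
    (hfo : ∀ η > 0, ∀ᶠ t in 𝓝[>] (0 : ℝ), volume.real (A - t • A) ≤
      volume.real A * (1 + (Module.finrank ℝ E + η) * t)) :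
    volume ((2⁻¹ : ℝ) • (A - A)) ≤ volume A := by
  set d := Module.finrank ℝ E with hd
  set v := volume.real A with hv
  have hv0 : 0 < v := by
    rw [hv, measureReal_def, ENNReal.toReal_pos_iff]
    exact ⟨(isOpen_interior.measure_pos _ hAi).trans_le (measure_mono interior_subset),
      hA.measure_lt_top⟩
  set w : ℝ → ℝ := fun s => volume.real ((1 - s) • A + s • (-A)) with hw
  set g : ℕ → ℝ := fun m => w (2⁻¹ ^ (m + 1)) / v with hg
  have hg0 : ∀ m, 0 ≤ g m := fun m => div_nonneg measureReal_nonneg hv0.le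
  have hstep : ∀ m, g m ≤ g (m + 1) ^ 2 := by
    intro m
    have h1 := volumeReal_smul_add_smul_neg_le_sq hA hAc (s := 2⁻¹ ^ (m + 1))
      (pow_le_one₀ (by norm_num) (by norm_num))
    have h2 : (2⁻¹ : ℝ) ^ (m + 1) / 2 = 2⁻¹ ^ (m + 1 + 1) := by ring
    rw [h2] at h1
    simp only [hg, hw]
    rw [div_pow, div_le_div_iff₀ hv0 (by positivity)]
    nlinarith
  have hiter : ∀ m, g 0 ≤ g m ^ 2 ^ m := by
    intro m
    induction m with
    | zero => simp
    | succ m ih =>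
      calc g 0 ≤ g m ^ 2 ^ m := ih
        _ ≤ (g (m + 1) ^ 2) ^ 2 ^ m := pow_le_pow_left₀ (hg0 m) (hstep m) _
        _ = _ := by rw [← pow_mul, pow_succ' 2 m]
  have hws : ∀ t : ℝ, 0 < t → w (t / (1 + t)) = ((1 + t)⁻¹) ^ d * volume.real (A - t • A) := by
    intro t ht
    have e : (1 - t / (1 + t)) • A + (t / (1 + t)) • (-A) = (1 + t)⁻¹ • (A - t • A) := by
      have : 1 - t / (1 + t) = (1 + t)⁻¹ := by field_simp; ring
      rw [this, sub_eq_add_neg, smul_add, ← smul_set_neg, smul_smul]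
      congr 3
      rw [div_eq_inv_mul]
    simp only [hw]
    rw [e, measureReal_def, Measure.addHaar_smul, ENNReal.toReal_mul, measureReal_def]
    congr 1
    rw [ENNReal.toReal_ofReal (abs_nonneg _), abs_of_pos (by positivity)]
  have hlim : ∀ η > 0, g 0 ≤ Real.exp η := by
    intro η hη
    have htend : Tendsto (fun m : ℕ => (2⁻¹ : ℝ) ^ (m + 1) / (1 - 2⁻¹ ^ (m + 1)))
        atTop (𝓝[>] 0) := by
      refine tendsto_nhdsWithin_iff.2 ⟨?_, .of_forall fun m => ?_⟩
      · have h1 : Tendsto (fun m : ℕ => (2⁻¹ : ℝ) ^ (m + 1)) atTop (𝓝 0) :=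
          (tendsto_pow_atTop_nhds_zero_of_lt_one (by norm_num) (by norm_num)).comp
            (tendsto_add_atTop_nat 1)
        have h2 := h1.div (tendsto_const_nhds.sub h1) (by norm_num : (1 : ℝ) - 0 ≠ 0)
        rw [sub_zero, div_one] at h2
        exact h2
      · have : (2⁻¹ : ℝ) ^ (m + 1) < 1 := pow_lt_one₀ (by norm_num) (by norm_num) (by simp)
        change (0 : ℝ) < 2⁻¹ ^ (m + 1) / (1 - 2⁻¹ ^ (m + 1))
        exact div_pos (by positivity) (sub_pos.2 this)
    obtain ⟨m, hm⟩ := (htend.eventually (hfo η hη)).exists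
    set s : ℝ := 2⁻¹ ^ (m + 1) with hs
    have hs0 : 0 < s := by positivity
    have hs2 : s ≤ 2⁻¹ := by
      rw [hs, pow_succ]
      have : (2⁻¹ : ℝ) ^ m ≤ 1 := pow_le_one₀ (by norm_num) (by norm_num)
      linarith
    set t : ℝ := s / (1 - s) with ht
    have h1s : 0 < 1 - s := by linarith
    have ht0 : 0 < t := by positivity
    have hst : t / (1 + t) = s := by rw [ht]; field_simp; ring
    have ht2 : t ≤ 2 * s := by
      rw [ht, div_le_iff₀ h1s]; nlinarith
    have hgm : g m ≤ Real.exp (η * t) := by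
      have h1 : g m = ((1 + t)⁻¹) ^ d * volume.real (A - t • A) / v := by
        simp only [hg]
        rw [← hs, ← hst, hws t ht0]
      have hbern : 1 + d * t ≤ (1 + t) ^ d := one_add_mul_le_pow (by linarith) d
      have h2 : 1 + (d + η) * t ≤ (1 + t) ^ d * (1 + η * t) := by
        calc 1 + (d + η) * t ≤ (1 + d * t) * (1 + η * t) := by
              have : 0 ≤ d * t * (η * t) := by positivity
              linarith
          _ ≤ _ := by gcongr
      rw [h1, div_le_iff₀ hv0]
      calc ((1 + t)⁻¹) ^ d * volume.real (A - t • A)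
          ≤ ((1 + t)⁻¹) ^ d * (v * ((1 + t) ^ d * (1 + η * t))) := by
            gcongr; exact hm.trans (by gcongr)
        _ = (1 + η * t) * v := by rw [inv_pow]; field_simp
        _ ≤ _ := by gcongr; linarith [Real.add_one_le_exp (η * t)]
    calc g 0 ≤ g m ^ 2 ^ m := hiter m
      _ ≤ Real.exp (η * t) ^ 2 ^ m := pow_le_pow_left₀ (hg0 m) hgm _
      _ = Real.exp (2 ^ m * (η * t)) := by rw [← Real.exp_nat_mul]; push_cast; rfl
      _ ≤ Real.exp η := by
        refine Real.exp_le_exp.2 ?_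
        calc (2 : ℝ) ^ m * (η * t) ≤ 2 ^ m * (η * (2 * s)) := by gcongr
          _ = η := by rw [hs, inv_pow, pow_succ]; field_simp
  have h1 : g 0 ≤ 1 := by
    have : Tendsto Real.exp (𝓝[>] 0) (𝓝 1) := by
      simpa using (Real.continuous_exp.tendsto 0).mono_left nhdsWithin_le_nhds
    exact ge_of_tendsto this (eventually_nhdsWithin_of_forall fun η hη => hlim η hη)
  have h2 : w 2⁻¹ ≤ v := by simpa [hg, div_le_one hv0] using h1
  have e : (2⁻¹ : ℝ) • (A - A) = (1 - 2⁻¹ : ℝ) • A + (2⁻¹ : ℝ) • (-A) := by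
    rw [sub_eq_add_neg, smul_add]; norm_num
  have hfin : volume ((2⁻¹ : ℝ) • (A - A)) ≠ ⊤ := by
    rw [sub_eq_add_neg]; exact ((hA.add hA.neg).smul _).measure_ne_top
  rw [← ENNReal.toReal_le_toReal hfin hA.measure_ne_top, e]
  exact h2

end

section

variable {E : Type*} [NormedAddCommGroup E] [InnerProductSpace ℝ E] [FiniteDimensional ℝ E]
    [MeasurableSpace E] [BorelSpace E]

lemma volume_setOf_inner_eq {w : E} (hw : w ≠ 0) (c : ℝ) : volume {x : E | ⟪w, x⟫_ℝ = c} = 0 := by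
  rcases eq_empty_or_nonempty {x : E | ⟪w, x⟫_ℝ = c} with h | ⟨x₀, hx₀⟩
  · simp [h]
  have hx₀ : ⟪w, x₀⟫_ℝ = c := hx₀
  have hsub : {x : E | ⟪w, x⟫_ℝ = c} ⊆ x₀ +ᵥ (((ℝ ∙ w)ᗮ : Submodule ℝ E) : Set E) := by
    intro x hx
    have hx : ⟪w, x⟫_ℝ = c := hx
    refine ⟨x - x₀, ?_, by simp⟩
    rw [SetLike.mem_coe, Submodule.mem_orthogonal_singleton_iff_inner_right, inner_sub_right, hx,
      hx₀, sub_self]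
  refine measure_mono_null hsub ?_
  rw [measure_vadd]
  refine Measure.addHaar_submodule _ _ fun h => hw ?_
  have : w ∈ (ℝ ∙ w)ᗮ := h ▸ Submodule.mem_top
  rw [Submodule.mem_orthogonal_singleton_iff_inner_right] at this
  exact inner_self_eq_zero.1 this

/-- The measure of the slice of `S` by the hyperplane at height `r` in direction `u`. -/
noncomputable def sliceVolume (u : E) (r : ℝ) (S : Set E) : ℝ≥0∞ :=
  volume {z : ((ℝ ∙ u)ᗮ : Submodule ℝ E) | (z : E) + r • u ∈ S}

omit [FiniteDimensional ℝ E] [MeasurableSpace E] [BorelSpace E] in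
lemma inner_coe_add_smul {u : E} (hu : ‖u‖ = 1) (z : ((ℝ ∙ u)ᗮ : Submodule ℝ E)) (r : ℝ) :
    ⟪u, (z : E) + r • u⟫_ℝ = r := by
  rw [inner_add_right, inner_smul_right, real_inner_self_eq_norm_sq, hu,
    Submodule.mem_orthogonal_singleton_iff_inner_right.1 z.2]
  simp

omit [FiniteDimensional ℝ E] [MeasurableSpace E] [BorelSpace E] in
lemma exists_eq_coe_add_inner_smul {u : E} (hu : ‖u‖ = 1) (x : E) :
    ∃ z : ((ℝ ∙ u)ᗮ : Submodule ℝ E), x = (z : E) + ⟪u, x⟫_ℝ • u := by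
  refine ⟨⟨x - ⟪u, x⟫_ℝ • u, ?_⟩, by simp⟩
  rw [Submodule.mem_orthogonal_singleton_iff_inner_right, inner_sub_right, inner_smul_right,
    real_inner_self_eq_norm_sq, hu]
  simp

lemma sliceVolume_lt_top {u : E} {r : ℝ} {S : Set E} (h : Bornology.IsBounded S) :
    sliceVolume u r S < ⊤ := by
  obtain ⟨M, hM⟩ := h.exists_norm_le
  refine Bornology.IsBounded.measure_lt_top (isBounded_iff_forall_norm_le.2 ⟨M + ‖r • u‖, ?_⟩)
  intro z hz
  have h1 := hM _ hz
  have h2 : ‖(z : E)‖ ≤ ‖(z : E) + r • u‖ + ‖r • u‖ := by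
    simpa using norm_sub_le ((z : E) + r • u) (r • u)
  exact h2.trans (by gcongr)

lemma sliceVolume_vadd {u : E} (hu : ‖u‖ = 1) (r : ℝ) (x : E) (S : Set E) :
    sliceVolume u (r + ⟪u, x⟫_ℝ) (x +ᵥ S) = sliceVolume u r S := by
  obtain ⟨w, hw⟩ := exists_eq_coe_add_inner_smul hu x
  generalize ⟪u, x⟫_ℝ = c at hw ⊢
  subst hw
  have : {z : ((ℝ ∙ u)ᗮ : Submodule ℝ E) | (z : E) + (r + c) • u ∈ (w + c • u : E) +ᵥ S} =
      w +ᵥ {z : ((ℝ ∙ u)ᗮ : Submodule ℝ E) | (z : E) + r • u ∈ S} := by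
    ext z
    rw [mem_vadd_set_iff_neg_vadd_mem, mem_ofPred_eq, mem_ofPred_eq, mem_vadd_set_iff_neg_vadd_mem]
    have : -(w + c • u : E) +ᵥ ((z : E) + (r + c) • u) =
        ((-w +ᵥ z : ((ℝ ∙ u)ᗮ : Submodule ℝ E)) : E) + r • u := by
      simp only [vadd_eq_add, Submodule.coe_add, Submodule.coe_neg]
      module
    rw [this]
  rw [sliceVolume, this, measure_vadd, sliceVolume]

lemma sliceVolume_neg (u : E) (r : ℝ) (S : Set E) :
    sliceVolume u (-r) (-S) = sliceVolume u r S := by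
  have : {z : ((ℝ ∙ u)ᗮ : Submodule ℝ E) | (z : E) + (-r) • u ∈ -S} =
      -{z : ((ℝ ∙ u)ᗮ : Submodule ℝ E) | (z : E) + r • u ∈ S} := by
    ext z
    rw [mem_ofPred_eq, Set.mem_neg, Set.mem_neg, mem_ofPred_eq]
    congr! 1
    rw [Submodule.coe_neg]
    module
  rw [sliceVolume, this, Measure.measure_neg, sliceVolume]

lemma sliceVolume_neg_left (u : E) (r : ℝ) (S : Set E) :
    sliceVolume (-u) r S = sliceVolume u (-r) S := by
  have key : ∀ W W' : Submodule ℝ E, W = W' → ∀ p : E,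
      volume {z : (Wᗮ : Submodule ℝ E) | (z : E) + p ∈ S} =
        volume {z : (W'ᗮ : Submodule ℝ E) | (z : E) + p ∈ S} := by
    rintro W _ rfl p; rfl
  rw [sliceVolume, sliceVolume, key (ℝ ∙ (-u)) (ℝ ∙ u)]
  · simp
  · rw [← Set.neg_singleton, Submodule.span_neg]

lemma measurePreserving_smul_add {u : E} (hu : ‖u‖ = 1) :
    MeasurePreserving fun p : ℝ × ((ℝ ∙ u)ᗮ : Submodule ℝ E) => (p.2 : E) + p.1 • u := by
  have h1 := ((LinearIsometryEquiv.toSpanUnitSingleton (𝕜 := ℝ) u hu).measurePreserving).prod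
    (MeasurePreserving.id (volume : Measure ((ℝ ∙ u)ᗮ : Submodule ℝ E)))
  have h2 := (WithLp.volume_preserving_toLp (ℝ ∙ u) ((ℝ ∙ u)ᗮ : Submodule ℝ E)).comp h1
  have h3 := ((ℝ ∙ u).orthogonalDecomposition.symm.measurePreserving).comp h2
  convert h3 using 1
  · ext p
    simp [add_comm]
  · rfl

lemma volume_eq_lintegral_sliceVolume {u : E} (hu : ‖u‖ = 1) {S : Set E} (hS : MeasurableSet S) :
    volume S = ∫⁻ r, sliceVolume u r S := by
  rw [← (measurePreserving_smul_add hu).measure_preimage hS.nullMeasurableSet,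
    Measure.volume_eq_prod, Measure.prod_apply ((measurePreserving_smul_add hu).measurable hS)]
  rfl

end

section

variable {E : Type*} [NormedAddCommGroup E] [InnerProductSpace ℝ E] [FiniteDimensional ℝ E]
    [MeasurableSpace E] [BorelSpace E]

/-- The intersection of the half-spaces with normals `v ∈ N` and heights `h v`. -/
def polyhedron {E : Type*} [NormedAddCommGroup E] [InnerProductSpace ℝ E] (N : Finset E)
    (h : E → ℝ) : Set E :=
  {x | ∀ v ∈ N, ⟪v, x⟫_ℝ ≤ h v}

omit [FiniteDimensional ℝ E] [MeasurableSpace E] [BorelSpace E] in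
lemma isClosed_polyhedron (N : Finset E) (h : E → ℝ) : IsClosed (polyhedron N h) := by
  have : polyhedron N h = ⋂ v ∈ N, {x | ⟪v, x⟫_ℝ ≤ h v} := by
    ext; simp [polyhedron]
  rw [this]
  exact isClosed_biInter fun v _ => isClosed_le (by fun_prop) continuous_const

lemma volume_polyhedron_sub_smul_le {N : Finset E} {h : E → ℝ} (hN : ∀ v ∈ N, ‖v‖ = 1)
    (hneg : ∀ v ∈ N, -v ∈ N) {R t : ℝ}
    (hR : ∀ u ∈ N, ∀ v ∈ N, h (-v) + h (-u) ≤ R * h v) (ht : 0 ≤ t) :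
    volume (polyhedron N h - t • polyhedron N h) ≤ volume (polyhedron N h) +
      ∑ u ∈ N, ENNReal.ofReal (t * h (-u)) *
        sliceVolume u (h u) (polyhedron N fun v => (1 + t * R) * h v) := by
  set P := polyhedron N fun v => h v + t * h (-v) with hP
  have hPm : MeasurableSet P := (isClosed_polyhedron _ _).measurableSet
  have hsub : polyhedron N h - t • polyhedron N h ⊆
      polyhedron N h ∪ ⋃ u ∈ N, P ∩ {x | h u < ⟪u, x⟫_ℝ} := by
    rintro _ ⟨a, ha, _, ⟨b, hb, rfl⟩, rfl⟩
    have hmem : a - t • b ∈ P := by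
      intro v hv
      have h1 := ha v hv
      have h2 := hb (-v) (hneg v hv)
      rw [inner_neg_left] at h2
      rw [inner_sub_right, inner_smul_right]
      nlinarith
    by_cases hx : a - t • b ∈ polyhedron N h
    · exact Or.inl hx
    · right
      simp only [polyhedron, mem_ofPred_eq, not_forall, not_le] at hx
      obtain ⟨u, hu, hx⟩ := hx
      exact mem_biUnion hu ⟨hmem, hx⟩
  refine (measure_mono hsub).trans ((measure_union_le _ _).trans ?_)
  gcongr
  refine (measure_biUnion_finset_le _ _).trans (Finset.sum_le_sum fun u hu => ?_)
  rw [volume_eq_lintegral_sliceVolume (hN u hu)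
    (hPm.inter (measurableSet_lt measurable_const (by fun_prop)))]
  calc ∫⁻ r, sliceVolume u r (P ∩ {x | h u < ⟪u, x⟫_ℝ})
      ≤ ∫⁻ r, (Ioc (h u) (h u + t * h (-u))).indicator (fun _ =>
          sliceVolume u (h u) (polyhedron N fun v => (1 + t * R) * h v)) r := by
        refine lintegral_mono fun r => ?_
        by_cases hr : r ∈ Ioc (h u) (h u + t * h (-u))
        · rw [indicator_of_mem hr]
          refine measure_mono fun z hz v hv => ?_
          have h1 := hz.1 v hv
          have h2 : |⟪v, u⟫_ℝ| ≤ 1 := by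
            simpa [hN v hv, hN u hu] using abs_real_inner_le_norm v u
          have h3 := hR u hu v hv
          rw [inner_add_right, inner_smul_right] at h1 ⊢
          have h4 : (h u - r) * ⟪v, u⟫_ℝ ≤ r - h u := by
            have := hr.1
            nlinarith [abs_le.1 h2]
          have := hr.2
          nlinarith
        · rw [indicator_of_notMem hr, sliceVolume, nonpos_iff_eq_zero]
          refine measure_mono_null (t := ∅) (fun z hz => (hr ?_).elim) measure_empty
          have h1 := hz.1 u hu
          have h2 : h u < _ := hz.2
          rw [inner_coe_add_smul (hN u hu)] at h1 h2
          exact ⟨h2, h1⟩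
    _ = _ := by
        rw [lintegral_indicator_const measurableSet_Ioc, Real.volume_Ioc, mul_comm]
        congr 2
        ring

lemma sum_mul_sliceVolume_le {N : Finset E} {h : E → ℝ} (hN : ∀ v ∈ N, ‖v‖ = 1)
    (h0 : ∀ v ∈ N, 0 < h v) :
    ∑ u ∈ N, ENNReal.ofReal (h u) * sliceVolume u (h u) (polyhedron N h) ≤
      Module.finrank ℝ E * volume (polyhedron N h) := by
  set A := polyhedron N h with hA
  have hAm : MeasurableSet A := (isClosed_polyhedron _ _).measurableSet
  set C : E → Set E := fun u => {x | 0 < ⟪u, x⟫_ℝ ∧ ⟪u, x⟫_ℝ ≤ h u ∧ (h u / ⟪u, x⟫_ℝ) • x ∈ A}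
    with hC
  have hCm : ∀ u, MeasurableSet (C u) := by
    intro u
    have h1 : Measurable fun x : E => ⟪u, x⟫_ℝ := by fun_prop
    exact (measurableSet_lt measurable_const h1).inter ((measurableSet_le h1 measurable_const).inter
      (((measurable_const.div h1).smul measurable_id) hAm))
  have hCA : ⋃ u ∈ N, C u ⊆ A := by
    refine iUnion₂_subset fun u hu x ⟨hx0, hx1, hx⟩ v hv => ?_
    have h1 := hx v hv
    have h2 := h0 u hu
    rw [inner_smul_right, div_mul_eq_mul_div, div_le_iff₀ hx0] at h1
    have h3 : h u * ⟪v, x⟫_ℝ ≤ h u * h v := by nlinarith [h0 v hv]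
    exact le_of_mul_le_mul_left h3 h2
  have hdisj : (N : Set E).Pairwise (Function.onFun (AEDisjoint volume) C) := by
    intro u hu v hv huv
    have hw : (h v) • u - (h u) • v ≠ 0 := by
      intro hw
      have h1 := congrArg norm (sub_eq_zero.1 hw)
      rw [norm_smul, norm_smul, hN u hu, hN v hv, mul_one, mul_one,
        Real.norm_of_nonneg (h0 v hv).le, Real.norm_of_nonneg (h0 u hu).le] at h1
      rw [h1, ← smul_sub, smul_eq_zero, sub_eq_zero] at hw
      exact hw.elim (h0 u hu).ne' huv
    refine measure_mono_null ?_ (volume_setOf_inner_eq hw 0)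
    rintro x ⟨⟨hx0, -, hx⟩, ⟨hy0, -, hy⟩⟩
    have h1 := hx v hv
    have h2 := hy u hu
    rw [inner_smul_right, div_mul_eq_mul_div, div_le_iff₀ hx0] at h1
    rw [inner_smul_right, div_mul_eq_mul_div, div_le_iff₀ hy0] at h2
    rw [mem_ofPred_eq, inner_sub_left, inner_smul_left, inner_smul_left]
    simp only [conj_trivial]
    linarith
  rcases N.eq_empty_or_nonempty with rfl | ⟨u₀, hu₀⟩
  · simp
  have hd : Module.finrank ℝ E ≠ 0 := by
    intro hd
    have := Module.finrank_zero_iff.1 hd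
    have h1 := hN u₀ hu₀
    rw [Subsingleton.elim u₀ 0, norm_zero] at h1
    exact zero_ne_one h1
  obtain ⟨n, hn⟩ := Nat.exists_eq_succ_of_ne_zero hd
  have hvol : ∀ u ∈ N, ENNReal.ofReal (h u) * sliceVolume u (h u) A ≤
      Module.finrank ℝ E * volume (C u) := by
    intro u hu
    have hu0 := h0 u hu
    have hrank : Module.finrank ℝ ((ℝ ∙ u)ᗮ : Submodule ℝ E) = n := by
      have h1 : u ≠ 0 := by
        rintro rfl; simpa using hN 0 hu
      have : Fact (Module.finrank ℝ E = n + 1) := ⟨hn⟩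
      exact Submodule.finrank_orthogonal_span_singleton h1
    have hsl : ∀ s ∈ Ioc 0 (h u), sliceVolume u s (C u) =
        ENNReal.ofReal ((s / h u) ^ n) * sliceVolume u (h u) A := by
      intro s hs
      have hs0 : 0 < s := hs.1
      have : {z : ((ℝ ∙ u)ᗮ : Submodule ℝ E) | (z : E) + s • u ∈ C u} =
          (s / h u) • {z : ((ℝ ∙ u)ᗮ : Submodule ℝ E) | (z : E) + (h u) • u ∈ A} := by
        ext z
        rw [mem_smul_set_iff_inv_smul_mem₀ (by positivity)]
        simp only [hC, mem_ofPred_eq, inner_coe_add_smul (hN u hu)]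
        have e : (h u / s) • ((z : E) + s • u) =
            (((s / h u)⁻¹ • z : ((ℝ ∙ u)ᗮ : Submodule ℝ E)) : E) + h u • u := by
          rw [smul_add, smul_smul, div_mul_cancel₀ _ hs0.ne', inv_div, Submodule.coe_smul]
        rw [e]
        exact ⟨fun h => h.2.2, fun h => ⟨hs.1, hs.2, h⟩⟩
      rw [sliceVolume, this, Measure.addHaar_smul, hrank, sliceVolume,
        abs_of_nonneg (by positivity)]
    have hint : ENNReal.ofReal (h u) =
        Module.finrank ℝ E * ∫⁻ s in Ioc 0 (h u), ENNReal.ofReal ((s / h u) ^ n) := by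
      rw [← ofReal_integral_eq_lintegral_ofReal, ← intervalIntegral.integral_of_le hu0.le,
        intervalIntegral.integral_comp_div (fun x => x ^ n) hu0.ne', integral_pow, hn,
        ← ENNReal.ofReal_natCast, ← ENNReal.ofReal_mul (by positivity)]
      · congr 1
        rw [zero_div, div_self hu0.ne']
        push_cast
        simp
        field_simp
      · exact (Continuous.continuousOn (by fun_prop)).integrableOn_compact isCompact_Icc |>.mono_set
          Ioc_subset_Icc_self
      · refine ae_restrict_of_forall_mem measurableSet_Ioc fun s hs => ?_
        have := hs.1
        exact pow_nonneg (div_nonneg this.le hu0.le) _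
    rw [hint, mul_assoc, ← lintegral_mul_const _ (by fun_prop),
      volume_eq_lintegral_sliceVolume (hN u hu) (hCm u)]
    refine mul_le_mul le_rfl ?_ zero_le zero_le
    rw [← setLIntegral_congr_fun measurableSet_Ioc hsl]
    exact setLIntegral_le_lintegral _ _
  calc _ ≤ ∑ u ∈ N, Module.finrank ℝ E * volume (C u) := Finset.sum_le_sum hvol
    _ = Module.finrank ℝ E * volume (⋃ u ∈ N, C u) := by
      rw [← Finset.mul_sum, measure_biUnion_finset₀ hdisj fun u _ => (hCm u).nullMeasurableSet]
    _ ≤ _ := by gcongr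

lemma tendsto_sliceVolume_polyhedron {N : Finset E} {h : E → ℝ} (h0 : ∀ v ∈ N, 0 < h v)
    (hA : IsCompact (polyhedron N h)) {R : ℝ} (hR : 0 ≤ R) (u : E) (r : ℝ) :
    Tendsto (fun t : ℝ => sliceVolume u r (polyhedron N fun v => (1 + t * R) * h v)) (𝓝[>] 0)
      (𝓝 (sliceVolume u r (polyhedron N h))) := by
  have hmono : ∀ i j : ℝ, 0 < i → i ≤ j → polyhedron N (fun v => (1 + i * R) * h v) ⊆
      polyhedron N fun v => (1 + j * R) * h v := by
    intro i j _ hij x hx v hv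
    refine (hx v hv).trans ?_
    have := h0 v hv
    change (1 + i * R) * h v ≤ (1 + j * R) * h v
    gcongr
  have hbd : Bornology.IsBounded (polyhedron N fun v => (1 + 1 * R) * h v) := by
    refine (hA.smul (1 + R)).isBounded.subset fun x hx => ?_
    have hpos : 0 < 1 + R := by positivity
    rw [mem_smul_set_iff_inv_smul_mem₀ hpos.ne']
    intro v hv
    have := hx v hv
    rw [inner_smul_right, inv_mul_le_iff₀ hpos]
    simpa using this
  have key := tendsto_measure_biInter_gt (μ := (volume : Measure ((ℝ ∙ u)ᗮ : Submodule ℝ E)))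
    (s := fun t : ℝ => {z : ((ℝ ∙ u)ᗮ : Submodule ℝ E) |
      (z : E) + r • u ∈ polyhedron N fun v => (1 + t * R) * h v}) (a := 0)
    (fun t _ => ((isClosed_polyhedron _ _).preimage
      (by fun_prop : Continuous fun z : ((ℝ ∙ u)ᗮ : Submodule ℝ E) => (z : E) + r • u)
        ).measurableSet.nullMeasurableSet)
    (fun i j hi hij z hz => hmono i j hi hij hz)
    ⟨1, one_pos, (sliceVolume_lt_top hbd).ne⟩
  have hInter : ⋂ t > (0 : ℝ), {z : ((ℝ ∙ u)ᗮ : Submodule ℝ E) |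
      (z : E) + r • u ∈ polyhedron N fun v => (1 + t * R) * h v} =
      {z : ((ℝ ∙ u)ᗮ : Submodule ℝ E) | (z : E) + r • u ∈ polyhedron N h} := by
    ext z
    simp only [mem_iInter, mem_ofPred_eq]
    constructor
    · intro H v hv
      have hlim : Tendsto (fun t : ℝ => (1 + t * R) * h v) (𝓝[>] 0) (𝓝 ((1 + 0 * R) * h v)) :=
        (Continuous.tendsto (by fun_prop) 0).mono_left nhdsWithin_le_nhds
      rw [zero_mul, add_zero, one_mul] at hlim
      exact ge_of_tendsto hlim (eventually_nhdsWithin_of_forall fun t ht => H t ht v hv)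
    · intro H t ht v hv
      have := h0 v hv
      refine (H v hv).trans ?_
      have : 0 ≤ t * R * h v := by positivity
      linarith
  rw [hInter] at key
  exact key

lemma volume_polyhedron_first_order {N : Finset E} {h : E → ℝ} (hN : ∀ v ∈ N, ‖v‖ = 1)
    (hneg : ∀ v ∈ N, -v ∈ N) (h0 : ∀ v ∈ N, 0 < h v) (hA : IsCompact (polyhedron N h))
    (hv : volume (polyhedron N h) ≠ 0)
    (heven : ∀ u ∈ N, sliceVolume u (h u) (polyhedron N h) =
      sliceVolume (-u) (h (-u)) (polyhedron N h)) :
    ∀ η > 0, ∀ᶠ t in 𝓝[>] (0 : ℝ), volume.real (polyhedron N h - t • polyhedron N h) ≤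
      volume.real (polyhedron N h) * (1 + (Module.finrank ℝ E + η) * t) := by
  intro η hη
  set A := polyhedron N h with hAdef
  have hfin : volume A ≠ ⊤ := hA.measure_ne_top
  obtain ⟨R, hR0, hR⟩ : ∃ R : ℝ, 0 ≤ R ∧ ∀ u ∈ N, ∀ v ∈ N, h (-v) + h (-u) ≤ R * h v := by
    obtain ⟨M, hM⟩ := ((N ×ˢ N).image fun p => (h (-p.2) + h (-p.1)) / h p.2).exists_le
    refine ⟨max M 0, le_max_right _ _, fun u hu v hv => ?_⟩
    rw [← div_le_iff₀ (h0 v hv)]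
    exact (hM _ (Finset.mem_image_of_mem _ (Finset.mk_mem_product hu hv))).trans (le_max_left _ _)
  set F : ℝ → ℝ≥0∞ := fun t => ∑ u ∈ N, ENNReal.ofReal (h (-u)) *
    sliceVolume u (h u) (polyhedron N fun v => (1 + t * R) * h v) with hF
  have hlim : Tendsto F (𝓝[>] 0) (𝓝 (∑ u ∈ N, ENNReal.ofReal (h (-u)) * sliceVolume u (h u) A)) :=
    tendsto_finsetSum _ fun u _ => ENNReal.Tendsto.const_mul
      (tendsto_sliceVolume_polyhedron h0 hA hR0 u (h u)) (.inr ENNReal.ofReal_ne_top)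
  have hsum : ∑ u ∈ N, ENNReal.ofReal (h (-u)) * sliceVolume u (h u) A ≤
      Module.finrank ℝ E * volume A := by
    refine le_trans (le_of_eq ?_) (sum_mul_sliceVolume_le hN h0)
    refine Finset.sum_bij' (fun u _ => -u) (fun u _ => -u) hneg hneg (by simp) (by simp) ?_
    intro u hu
    rw [heven u hu]
  have hlt : ∑ u ∈ N, ENNReal.ofReal (h (-u)) * sliceVolume u (h u) A <
      ENNReal.ofReal (Module.finrank ℝ E + η) * volume A := by
    refine hsum.trans_lt ?_
    rw [ENNReal.mul_lt_mul_iff_left hv hfin, ← ENNReal.ofReal_natCast]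
    exact (ENNReal.ofReal_lt_ofReal_iff (by positivity)).2 (by linarith)
  filter_upwards [hlim.eventually_lt_const hlt, self_mem_nhdsWithin] with t ht ht0
  have ht0 : 0 < t := ht0
  have h1 := volume_polyhedron_sub_smul_le hN hneg hR ht0.le
  have h2 : volume (A - t • A) ≤ ENNReal.ofReal (1 + (Module.finrank ℝ E + η) * t) * volume A := by
    refine h1.trans ?_
    have e : ∑ u ∈ N, ENNReal.ofReal (t * h (-u)) *
        sliceVolume u (h u) (polyhedron N fun v => (1 + t * R) * h v) = ENNReal.ofReal t * F t := by
      rw [hF, Finset.mul_sum]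
      refine Finset.sum_congr rfl fun u _ => ?_
      rw [ENNReal.ofReal_mul ht0.le, mul_assoc]
    rw [e, ENNReal.ofReal_add zero_le_one (by positivity), add_mul, ENNReal.ofReal_one, one_mul,
      ENNReal.ofReal_mul (by positivity), mul_comm (ENNReal.ofReal _) (ENNReal.ofReal t), mul_assoc]
    gcongr
  rw [measureReal_def, measureReal_def]
  refine (ENNReal.toReal_mono (ENNReal.mul_ne_top ENNReal.ofReal_ne_top hfin) h2).trans ?_
  rw [ENNReal.toReal_mul, ENNReal.toReal_ofReal (by positivity), mul_comm]

end

section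

variable {E : Type*} [NormedAddCommGroup E] [InnerProductSpace ℝ E] [FiniteDimensional ℝ E]
    [MeasurableSpace E] [BorelSpace E]

/-- The number of members of the family `P` containing `q`. -/
noncomputable def coverCount {α ι : Type*} (P : ι → Set α) (q : α) : ℝ≥0∞ :=
  ∑' i, (P i).indicator 1 q

lemma coverCount_congr {α β ι : Type*} {P : ι → Set α} {Q : ι → Set β} {p : α} {q : β}
    (h : ∀ i, p ∈ P i ↔ q ∈ Q i) :
    coverCount P p = coverCount Q q := by
  refine tsum_congr fun i => ?_
  by_cases hp : p ∈ P i
  · rw [indicator_of_mem hp, indicator_of_mem ((h i).1 hp), Pi.one_apply, Pi.one_apply]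
  · rw [indicator_of_notMem hp, indicator_of_notMem fun hq => hp ((h i).2 hq)]

lemma coverCount_eq_diff_add {α ι : Type*} {P F : ι → Set α} (h : ∀ i, F i ⊆ P i) (q : α) :
    coverCount P q = coverCount (fun i => P i \ F i) q + coverCount F q := by
  rw [coverCount, coverCount, coverCount, ← ENNReal.tsum_add]
  refine tsum_congr fun i => ?_
  by_cases hF : q ∈ F i
  · simp [hF, h i hF]
  · by_cases hP : q ∈ P i <;> simp [hF, hP]

lemma LocallyFinite.coverCount_ne_top {α ι : Type*} [TopologicalSpace α] {P : ι → Set α}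
    (h : LocallyFinite P) (q : α) : coverCount P q ≠ ⊤ := by
  have hfin := h.point_finite q
  rw [coverCount, tsum_eq_sum (s := hfin.toFinset) (by intro i hi; simpa using hi)]
  refine ENNReal.sum_ne_top.2 fun i _ => ?_
  exact ne_top_of_le_ne_top ENNReal.one_ne_top (indicator_le_self' (fun _ _ => zero_le) q)

omit [FiniteDimensional ℝ E] [MeasurableSpace E] [BorelSpace E] in
lemma eventually_mem_polyhedron_iff {N : Finset E} {u q : E} {h : E → ℝ} (hu : u ≠ -u)
    (huN : -u ∈ N) (hq : ∀ v ∈ N, v ≠ u → v ≠ -u → ⟪v, q⟫_ℝ ≠ h v) :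
    ∀ᶠ p in 𝓝 q, ⟪u, p⟫_ℝ < ⟪u, q⟫_ℝ →
      (p ∈ polyhedron N h ↔ q ∈ polyhedron N h \ {x | ⟪-u, x⟫_ℝ = h (-u)}) := by
  have key : ∀ v ∈ N, ∀ᶠ p in 𝓝 q, ⟪u, p⟫_ℝ < ⟪u, q⟫_ℝ →
      (⟪v, p⟫_ℝ ≤ h v ↔ ⟪v, q⟫_ℝ ≤ h v ∧ ¬ (v = -u ∧ ⟪v, q⟫_ℝ = h v)) := by
    intro v hv
    have hcont : Tendsto (fun p : E => ⟪v, p⟫_ℝ) (𝓝 q) (𝓝 ⟪v, q⟫_ℝ) :=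
      Continuous.tendsto (by fun_prop) q
    rcases lt_trichotomy ⟪v, q⟫_ℝ (h v) with hlt | heq | hgt
    · filter_upwards [hcont.eventually_lt_const hlt] with p hp _
      exact ⟨fun _ => ⟨hlt.le, fun h => hlt.ne h.2⟩, fun _ => hp.le⟩
    · by_cases hvu : v = u
      · subst hvu
        refine .of_forall fun p hp => ⟨fun _ => ⟨heq.le, fun h => hu h.1⟩, fun _ => ?_⟩
        exact hp.le.trans heq.le
      · by_cases hvu' : v = -u
        · subst hvu'
          refine .of_forall fun p hp => ⟨fun hp' => ?_, fun hp' => (hp'.2 ⟨rfl, heq⟩).elim⟩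
          rw [← heq, inner_neg_left, inner_neg_left] at hp'
          linarith
        · exact (hq v hv hvu hvu' heq).elim
    · filter_upwards [hcont.eventually_const_lt hgt] with p hp _
      exact ⟨fun h => (hp.not_ge h).elim, fun h => (hgt.not_ge h.1).elim⟩
  filter_upwards [(Filter.eventually_all_finset N).2 key] with p hp hpu
  constructor
  · intro h1
    refine ⟨fun v hv => ((hp v hv hpu).1 (h1 v hv)).1, fun h2 => ?_⟩
    exact ((hp _ huN hpu).1 (h1 _ huN)).2 ⟨rfl, h2⟩
  · rintro ⟨h1, h2⟩ v hv
    refine (hp v hv hpu).2 ⟨h1 v hv, ?_⟩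
    rintro ⟨rfl, h3⟩
    exact h2 h3

omit [FiniteDimensional ℝ E] [MeasurableSpace E] [BorelSpace E] in
lemma eventually_forall_mem_polyhedron_iff {ι : Type*} {N : Finset E} {u q : E} {h : ι → E → ℝ}
    (hloc : LocallyFinite fun i => polyhedron N (h i)) (hu : u ≠ -u)
    (huN : -u ∈ N) (hq : ∀ i, ∀ v ∈ N, v ≠ u → v ≠ -u → ⟪v, q⟫_ℝ ≠ h i v) :
    ∀ᶠ p in 𝓝 q, ⟪u, p⟫_ℝ < ⟪u, q⟫_ℝ → ∀ i,
      (p ∈ polyhedron N (h i) ↔ q ∈ polyhedron N (h i) \ {x | ⟪-u, x⟫_ℝ = h i (-u)}) := by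
  obtain ⟨U, hU, hfin⟩ := hloc q
  have h1 : ∀ᶠ p in 𝓝 q, ∀ i ∈ hfin.toFinset, ⟪u, p⟫_ℝ < ⟪u, q⟫_ℝ →
      (p ∈ polyhedron N (h i) ↔ q ∈ polyhedron N (h i) \ {x | ⟪-u, x⟫_ℝ = h i (-u)}) :=
    (Filter.eventually_all_finset _).2 fun i _ => eventually_mem_polyhedron_iff hu huN (hq i)
  filter_upwards [h1, hU] with p hp hpU hpu i
  by_cases hi : i ∈ hfin.toFinset
  · exact hp i hi hpu
  · simp only [Finite.mem_toFinset, mem_ofPred_eq, not_nonempty_iff_eq_empty] at hi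
    have e1 : p ∉ polyhedron N (h i) := fun h' => by
      have : p ∈ polyhedron N (h i) ∩ U := ⟨h', hpU⟩
      rw [hi] at this; exact this
    have e2 : q ∉ polyhedron N (h i) := fun h' => by
      have : q ∈ polyhedron N (h i) ∩ U := ⟨h', mem_of_mem_nhds hU⟩
      rw [hi] at this; exact this
    exact ⟨fun h' => (e1 h').elim, fun h' => (e2 h'.1).elim⟩

omit [FiniteDimensional ℝ E] [MeasurableSpace E] [BorelSpace E] in
lemma exists_mem_inner_lt {u q : E} (hu : u ≠ 0) {D : Set E} (hD : Dense D) {p : E → Prop}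
    (hp : ∀ᶠ x in 𝓝 q, ⟪u, x⟫_ℝ < ⟪u, q⟫_ℝ → p x) : ∃ x ∈ D, p x := by
  obtain ⟨U, hUp, hUo, hqU⟩ := eventually_nhds_iff.1 hp
  have hopen : IsOpen (U ∩ {x | ⟪u, x⟫_ℝ < ⟪u, q⟫_ℝ}) :=
    hUo.inter (isOpen_lt (by fun_prop) continuous_const)
  have hne : (U ∩ {x | ⟪u, x⟫_ℝ < ⟪u, q⟫_ℝ}).Nonempty := by
    have hlim : Tendsto (fun t : ℝ => q - t • u) (𝓝[>] 0) (𝓝 (q - (0 : ℝ) • u)) :=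
      (Continuous.tendsto (by fun_prop) 0).mono_left nhdsWithin_le_nhds
    rw [zero_smul, sub_zero] at hlim
    obtain ⟨t, ht, ht0⟩ :=
      ((hlim.eventually (hUo.eventually_mem hqU)).and self_mem_nhdsWithin).exists
    have ht0 : 0 < t := ht0
    refine ⟨q - t • u, ht, ?_⟩
    have : 0 < t * ‖u‖ ^ 2 := by positivity
    rw [mem_ofPred_eq, inner_sub_right, inner_smul_right, real_inner_self_eq_norm_sq]
    linarith
  obtain ⟨x, hxD, hx⟩ := hD.exists_mem_open hopen hne
  exact ⟨x, hxD, hUp x hx.1 hx.2⟩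

lemma ae_inner_coe_add_smul_ne {u v : E} (hu : ‖u‖ = 1) (hv : ‖v‖ = 1) (hvu : v ≠ u)
    (hvu' : v ≠ -u) (r c : ℝ) :
    ∀ᵐ z : ((ℝ ∙ u)ᗮ : Submodule ℝ E), ⟪v, (z : E) + r • u⟫_ℝ ≠ c := by
  obtain ⟨w, hw⟩ := exists_eq_coe_add_inner_smul hu v
  have hw0 : w ≠ 0 := by
    rintro rfl
    rw [Submodule.coe_zero, zero_add] at hw
    have h1 : |⟪u, v⟫_ℝ| = 1 := by
      have := congrArg norm hw
      rw [norm_smul, hu, hv, mul_one, Real.norm_eq_abs] at this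
      exact this.symm
    rcases (abs_eq zero_le_one).1 h1 with h2 | h2
    · rw [h2, one_smul] at hw; exact hvu hw
    · rw [h2, neg_one_smul] at hw; exact hvu' hw
  refine measure_mono_null ?_ (volume_setOf_inner_eq hw0 (c - r * ⟪v, u⟫_ℝ))
  intro z hz
  have hz : ⟪v, (z : E) + r • u⟫_ℝ = c := by simpa using hz
  rw [inner_add_right, inner_smul_right] at hz
  have h1 : ⟪w, z⟫_ℝ = ⟪v, (z : E)⟫_ℝ := by
    conv_rhs => rw [hw]
    rw [inner_add_left, inner_smul_left, Submodule.mem_orthogonal_singleton_iff_inner_right.1 z.2,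
      mul_zero, add_zero, Submodule.coe_inner]
  rw [mem_ofPred_eq, h1]
  linarith

/-- The face of a polyhedron in direction `u`. -/
def polyhedronFace {E : Type*} [NormedAddCommGroup E] [InnerProductSpace ℝ E] (N : Finset E)
    (h : E → ℝ) (u : E) : Set E :=
  polyhedron N h ∩ {x | ⟪u, x⟫_ℝ = h u}

lemma ae_forall_inner_coe_add_smul_ne {τ : Type*} [Countable τ] {N : Finset E}
    (hN : ∀ v ∈ N, ‖v‖ = 1) {u : E} (hu : ‖u‖ = 1) (r : ℝ) (c : τ → E → ℝ) :
    ∀ᵐ z : ((ℝ ∙ u)ᗮ : Submodule ℝ E), ∀ i, ∀ v ∈ N, v ≠ u → v ≠ -u →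
      ⟪v, (z : E) + r • u⟫_ℝ ≠ c i v := by
  refine ae_all_iff.2 fun i => (Filter.eventually_all_finset N).2 fun v hv => ?_
  by_cases h1 : v = u
  · exact .of_forall fun _ h => (h h1).elim
  by_cases h2 : v = -u
  · exact .of_forall fun _ _ h => (h h2).elim
  filter_upwards [ae_inner_coe_add_smul_ne hu (hN v hv) h1 h2 r (c i v)] with z hz _ _ using hz

omit [FiniteDimensional ℝ E] [MeasurableSpace E] [BorelSpace E] in
lemma coverCount_polyhedron_eq {τ : Type*} {N : Finset E} (c : τ → E → ℝ) (w q : E) :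
    coverCount (fun i => polyhedron N (c i)) q =
      coverCount (fun i => polyhedron N (c i) \ {x | ⟪w, x⟫_ℝ = c i w}) q +
        coverCount (fun i => polyhedronFace N (c i) w) q := by
  rw [coverCount_eq_diff_add (F := fun i => polyhedronFace N (c i) w)
    (fun i => inter_subset_left)]
  congr 1
  refine coverCount_congr fun i => ?_
  rw [polyhedronFace, sdiff_self_inter]

lemma coverCount_face_add_eq {ι κ : Type*} [Countable ι] [Countable κ] {N : Finset E}
    (hN : ∀ v ∈ N, ‖v‖ = 1) (hneg : ∀ v ∈ N, -v ∈ N) {a : ι → E → ℝ} {b : κ → E → ℝ}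
    (ha : LocallyFinite fun i => polyhedron N (a i))
    (hb : LocallyFinite fun j => polyhedron N (b j)) {k : ℝ≥0∞} (hk : k ≠ ⊤)
    (hae : ∀ᵐ p : E, coverCount (fun i => polyhedron N (a i)) p =
      k + coverCount (fun j => polyhedron N (b j)) p) {u : E} (hu : u ∈ N) (r : ℝ) :
    ∀ᵐ z : ((ℝ ∙ u)ᗮ : Submodule ℝ E),
      coverCount (fun i => polyhedronFace N (a i) u) ((z : E) + r • u) +
        coverCount (fun j => polyhedronFace N (b j) (-u)) ((z : E) + r • u) =
      coverCount (fun i => polyhedronFace N (a i) (-u)) ((z : E) + r • u) +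
        coverCount (fun j => polyhedronFace N (b j) u) ((z : E) + r • u) := by
  have hu1 := hN u hu
  have hu0 : u ≠ 0 := by rintro rfl; simp at hu1
  have huu : u ≠ -u := fun h => hu0 (by
    rw [eq_neg_iff_add_eq_zero, ← two_smul ℝ] at h
    simpa using h)
  filter_upwards [ae_forall_inner_coe_add_smul_ne hN hu1 r a,
    ae_forall_inner_coe_add_smul_ne hN hu1 r b] with z hza hzb
  set q : E := (z : E) + r • u
  have side : ∀ w : E, (w = u ∨ w = -u) →
      coverCount (fun i => polyhedron N (a i) \ {x | ⟪-w, x⟫_ℝ = a i (-w)}) q =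
      k + coverCount (fun j => polyhedron N (b j) \ {x | ⟪-w, x⟫_ℝ = b j (-w)}) q := by
    intro w hw
    have hww : w ≠ -w := by
      rcases hw with rfl | rfl
      · exact huu
      · rw [neg_neg]; exact huu.symm
    have hwN : -w ∈ N := by
      rcases hw with rfl | rfl
      · exact hneg _ hu
      · rwa [neg_neg]
    have hsw : ∀ v, v ≠ w → v ≠ -w → v ≠ u ∧ v ≠ -u := by
      rcases hw with rfl | rfl
      · exact fun v h1 h2 => ⟨h1, h2⟩
      · exact fun v h1 h2 => ⟨by rwa [neg_neg] at h2, h1⟩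
    have e1 := eventually_forall_mem_polyhedron_iff ha hww hwN (q := q)
      fun i v hv h1 h2 => hza i v hv (hsw v h1 h2).1 (hsw v h1 h2).2
    have e2 := eventually_forall_mem_polyhedron_iff hb hww hwN (q := q)
      fun i v hv h1 h2 => hzb i v hv (hsw v h1 h2).1 (hsw v h1 h2).2
    have hw0 : w ≠ 0 := fun h => hww (by simp [h])
    obtain ⟨p, hp, hp1, hp2⟩ := exists_mem_inner_lt hw0 (Measure.dense_of_ae hae)
      ((e1.and e2).mono fun p hp h => And.intro (hp.1 h) (hp.2 h))
    rw [← coverCount_congr hp1, ← coverCount_congr hp2]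
    exact hp
  have s1 := side u (.inl rfl)
  have s2 := side (-u) (.inr rfl)
  rw [neg_neg] at s2
  have ha1 := coverCount_polyhedron_eq (N := N) a u q
  have ha2 := coverCount_polyhedron_eq (N := N) a (-u) q
  have hb1 := coverCount_polyhedron_eq (N := N) b u q
  have hb2 := coverCount_polyhedron_eq (N := N) b (-u) q
  have hbt := hb.coverCount_ne_top q
  rw [s2] at ha1
  rw [s1] at ha2
  have hB1 : coverCount (fun j => polyhedron N (b j) \ {x | ⟪u, x⟫_ℝ = b j u}) q ≠ ⊤ :=
    ne_top_of_le_ne_top hbt (hb1 ▸ le_self_add)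
  have hB2 : coverCount (fun j => polyhedron N (b j) \ {x | ⟪-u, x⟫_ℝ = b j (-u)}) q ≠ ⊤ :=
    ne_top_of_le_ne_top hbt (hb2 ▸ le_self_add)
  set B1 := coverCount (fun j => polyhedron N (b j) \ {x | ⟪u, x⟫_ℝ = b j u}) q
  set B2 := coverCount (fun j => polyhedron N (b j) \ {x | ⟪-u, x⟫_ℝ = b j (-u)}) q
  have hfin : k + B1 + B2 ≠ ⊤ := by simp [hk, hB1, hB2]
  rw [← ENNReal.add_right_inj hfin]
  calc k + B1 + B2 + (coverCount (fun i => polyhedronFace N (a i) u) q +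
        coverCount (fun j => polyhedronFace N (b j) (-u)) q)
      = (k + B1 + coverCount (fun i => polyhedronFace N (a i) u) q) +
        (B2 + coverCount (fun j => polyhedronFace N (b j) (-u)) q) := by ring
    _ = (k + B2 + coverCount (fun i => polyhedronFace N (a i) (-u)) q) +
        (B1 + coverCount (fun j => polyhedronFace N (b j) u) q) := by
      rw [← ha1, ← hb2, ← ha2, ← hb1]
    _ = _ := by ring

end

section

variable {E : Type*} [NormedAddCommGroup E] [InnerProductSpace ℝ E] [FiniteDimensional ℝ E]
    [MeasurableSpace E] [BorelSpace E]

/-- The polynomially decaying weight `(1 + ε‖x‖)⁻ᵐ`. -/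
noncomputable def decayWeight {E : Type*} [NormedAddCommGroup E] (m : ℕ) (ε : ℝ) (x : E) : ℝ≥0∞ :=
  (ENNReal.ofReal (1 + ε * ‖x‖) ^ m)⁻¹

omit [InnerProductSpace ℝ E] [FiniteDimensional ℝ E] in
lemma measurable_decayWeight (m : ℕ) (ε : ℝ) : Measurable (decayWeight m ε : E → ℝ≥0∞) := by
  unfold decayWeight
  fun_prop

lemma decayWeight_ne_zero {E : Type*} [NormedAddCommGroup E] (m : ℕ) (ε : ℝ) (x : E) :
    decayWeight m ε x ≠ 0 := by
  simp [decayWeight, ENNReal.pow_eq_top_iff]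

lemma decayWeight_le_mul {E F : Type*} [NormedAddCommGroup E] [NormedAddCommGroup F] {m : ℕ}
    {ε δ c : ℝ} {x : E} {y : F} (hc : 0 < c) (h : 1 + δ * ‖y‖ ≤ c * (1 + ε * ‖x‖)) :
    decayWeight m ε x ≤ ENNReal.ofReal c ^ m * decayWeight m δ y := by
  have hc0 : ENNReal.ofReal c ^ m ≠ 0 := pow_ne_zero _ (by simpa using hc)
  have hct : ENNReal.ofReal c ^ m ≠ ⊤ := by finiteness
  have h1 : ENNReal.ofReal (1 + δ * ‖y‖) ^ m ≤
      ENNReal.ofReal c ^ m * ENNReal.ofReal (1 + ε * ‖x‖) ^ m := by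
    rw [← mul_pow, ← ENNReal.ofReal_mul hc.le]
    gcongr
  calc decayWeight m ε x = ENNReal.ofReal c ^ m *
        (ENNReal.ofReal c ^ m * ENNReal.ofReal (1 + ε * ‖x‖) ^ m)⁻¹ := by
        rw [ENNReal.mul_inv (.inl hc0) (.inl hct), ← mul_assoc, ENNReal.mul_inv_cancel hc0 hct,
          one_mul, decayWeight]
    _ ≤ _ := by rw [decayWeight]; gcongr

lemma decayWeight_add_le {E : Type*} [NormedAddCommGroup E] (m : ℕ) {ε C : ℝ} (hε : 0 ≤ ε)
    (hC : 0 ≤ C) (x : E) {g : E} (hg : ‖g‖ ≤ C) :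
    decayWeight m ε (x + g) ≤ ENNReal.ofReal (1 + ε * C) ^ m * decayWeight m ε x := by
  refine decayWeight_le_mul (by positivity) ?_
  have h1 : ‖x‖ ≤ ‖x + g‖ + C := by
    have := norm_sub_le (x + g) g
    rw [add_sub_cancel_right] at this
    linarith
  have h2 : 0 ≤ (ε * C) * (ε * ‖x + g‖) := by positivity
  nlinarith

lemma decayWeight_le_add {E : Type*} [NormedAddCommGroup E] (m : ℕ) {ε C : ℝ} (hε : 0 ≤ ε)
    (hC : 0 ≤ C) (x : E) {g : E} (hg : ‖g‖ ≤ C) :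
    decayWeight m ε x ≤ ENNReal.ofReal (1 + ε * C) ^ m * decayWeight m ε (x + g) := by
  simpa using decayWeight_add_le m hε hC (x + g) (g := -g) (by simpa using hg)

lemma tsum_decayWeight_ne_top {E : Type*} [NormedAddCommGroup E] {m : ℕ} {ι : Type*} {x : ι → E}
    (hx : ∑' i, decayWeight m 1 (x i) ≠ ⊤) {ε : ℝ} (hε : 0 < ε) (hε1 : ε ≤ 1) :
    ∑' i, decayWeight m ε (x i) ≠ ⊤ := by
  refine ne_top_of_le_ne_top (b := ENNReal.ofReal ε⁻¹ ^ m * ∑' i, decayWeight m 1 (x i))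
    (by finiteness) ?_
  rw [← ENNReal.tsum_mul_left]
  refine ENNReal.tsum_le_tsum fun i => decayWeight_le_mul (by positivity) ?_
  rw [mul_add, ← mul_assoc, inv_mul_cancel₀ hε.ne', mul_one]
  gcongr
  exact one_le_inv_iff₀.2 ⟨hε, hε1⟩

omit [FiniteDimensional ℝ E] [MeasurableSpace E] [BorelSpace E] in
lemma indicator_vadd_mul_eq_zero {u : E} {s : ℝ} {G : Set E}
    (hG : ∀ g ∈ G, ⟪u, g⟫_ℝ = s) (ρ : E → ℝ≥0∞) (x : E) {r : ℝ} (hr : r ≠ s + ⟪u, x⟫_ℝ)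
    (hu : ‖u‖ = 1) (z : ((ℝ ∙ u)ᗮ : Submodule ℝ E)) :
    (x +ᵥ G).indicator 1 ((z : E) + r • u) * ρ ((z : E) + r • u) = 0 := by
  rw [indicator_of_notMem, zero_mul]
  rintro ⟨g, hg, hgz⟩
  apply hr
  rw [← inner_coe_add_smul hu z r, ← hgz, ← hG g hg]
  simp only [vadd_eq_add, inner_add_right, add_comm]

lemma tsum_lintegral_coverCount_mul {u : E} (hu : ‖u‖ = 1) {s : ℝ} {G : Set E}
    (hG : ∀ g ∈ G, ⟪u, g⟫_ℝ = s) (hGm : MeasurableSet G) {ρ : E → ℝ≥0∞} (hρ : Measurable ρ)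
    {ι : Type*} [Countable ι] (x : ι → E) :
    ∑' r : ℝ, ∫⁻ z : ((ℝ ∙ u)ᗮ : Submodule ℝ E),
        coverCount (fun i => x i +ᵥ G) ((z : E) + r • u) * ρ ((z : E) + r • u) =
      ∑' i, ∫⁻ z : ((ℝ ∙ u)ᗮ : Submodule ℝ E),
        (x i +ᵥ G).indicator 1 ((z : E) + (s + ⟪u, x i⟫_ℝ) • u) *
          ρ ((z : E) + (s + ⟪u, x i⟫_ℝ) • u) := by
  have h1 : ∀ r : ℝ, ∫⁻ z : ((ℝ ∙ u)ᗮ : Submodule ℝ E),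
        coverCount (fun i => x i +ᵥ G) ((z : E) + r • u) * ρ ((z : E) + r • u) =
      ∑' i, ∫⁻ z : ((ℝ ∙ u)ᗮ : Submodule ℝ E),
        (x i +ᵥ G).indicator 1 ((z : E) + r • u) * ρ ((z : E) + r • u) := by
    intro r
    rw [← lintegral_tsum]
    · simp_rw [coverCount, ENNReal.tsum_mul_right]
    · intro i
      refine Measurable.aemeasurable ?_
      have h2 : Measurable fun z : ((ℝ ∙ u)ᗮ : Submodule ℝ E) => (z : E) + r • u := by fun_prop
      exact ((measurable_one.indicator (hGm.const_vadd (x i))).comp h2).mul (hρ.comp h2)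
  simp_rw [h1]
  rw [ENNReal.tsum_comm]
  refine tsum_congr fun i => tsum_eq_single _ fun r hr => ?_
  simp_rw [indicator_vadd_mul_eq_zero hG ρ (x i) hr hu, lintegral_zero]

omit [FiniteDimensional ℝ E] in
lemma measurable_indicator_vadd_comp {u : E} (r : ℝ) {G : Set E} (hGm : MeasurableSet G) (x : E) :
    Measurable fun z : ((ℝ ∙ u)ᗮ : Submodule ℝ E) =>
      (x +ᵥ G).indicator (1 : E → ℝ≥0∞) ((z : E) + r • u) := by
  have h2 : Measurable fun z : ((ℝ ∙ u)ᗮ : Submodule ℝ E) => (z : E) + r • u := by fun_prop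
  exact (measurable_one.indicator (hGm.const_vadd x)).comp h2

omit [FiniteDimensional ℝ E] in
lemma measurable_coverCount_mul_comp {u : E} (r : ℝ) {G : Set E} (hGm : MeasurableSet G)
    {ρ : E → ℝ≥0∞} (hρ : Measurable ρ) {ι : Type*} [Countable ι] (x : ι → E) :
    Measurable fun z : ((ℝ ∙ u)ᗮ : Submodule ℝ E) =>
      coverCount (fun i => x i +ᵥ G) ((z : E) + r • u) * ρ ((z : E) + r • u) := by
  have h2 : Measurable fun z : ((ℝ ∙ u)ᗮ : Submodule ℝ E) => (z : E) + r • u := by fun_prop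
  exact (Measurable.tsum fun i => measurable_indicator_vadd_comp r hGm (x i)).mul (hρ.comp h2)

lemma lintegral_indicator_vadd {u : E} (hu : ‖u‖ = 1) {s : ℝ} {G : Set E} (hGm : MeasurableSet G)
    (x : E) : ∫⁻ z : ((ℝ ∙ u)ᗮ : Submodule ℝ E),
        (x +ᵥ G).indicator 1 ((z : E) + (s + ⟪u, x⟫_ℝ) • u) = sliceVolume u s G := by
  have h2 : Measurable fun z : ((ℝ ∙ u)ᗮ : Submodule ℝ E) => (z : E) + (s + ⟪u, x⟫_ℝ) • u := by
    fun_prop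
  rw [← sliceVolume_vadd hu s x G, sliceVolume]
  exact lintegral_indicator_one (h2 (hGm.const_vadd x))

lemma tsum_lintegral_coverCount_mul_le {u : E} (hu : ‖u‖ = 1) {s : ℝ} {G : Set E}
    (hG : ∀ g ∈ G, ⟪u, g⟫_ℝ = s) (hGm : MeasurableSet G) {ρ : E → ℝ≥0∞} (hρ : Measurable ρ)
    {ι : Type*} [Countable ι] (x : ι → E) {M : ℝ≥0∞} (hM : ∀ y, ∀ g ∈ G, ρ (y + g) ≤ M * ρ y) :
    ∑' r : ℝ, ∫⁻ z : ((ℝ ∙ u)ᗮ : Submodule ℝ E),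
        coverCount (fun i => x i +ᵥ G) ((z : E) + r • u) * ρ ((z : E) + r • u) ≤
      M * ((∑' i, ρ (x i)) * sliceVolume u s G) := by
  rw [tsum_lintegral_coverCount_mul hu hG hGm hρ, ← ENNReal.tsum_mul_right, ← ENNReal.tsum_mul_left]
  refine ENNReal.tsum_le_tsum fun i => ?_
  rw [← mul_assoc, ← lintegral_indicator_vadd hu hGm (x i)]
  refine (lintegral_mono fun z => ?_).trans_eq
    (lintegral_const_mul _ (measurable_indicator_vadd_comp _ hGm _))
  · by_cases hz : (z : E) + (s + ⟪u, x i⟫_ℝ) • u ∈ x i +ᵥ G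
    · simp only [indicator_of_mem hz, Pi.one_apply, one_mul, mul_one]
      obtain ⟨g, hg, hgz⟩ := hz
      rw [← hgz]
      exact hM _ g hg
    · simp [indicator_of_notMem hz]

lemma mul_sliceVolume_le_tsum_lintegral {u : E} (hu : ‖u‖ = 1) {s : ℝ} {G : Set E}
    (hG : ∀ g ∈ G, ⟪u, g⟫_ℝ = s) (hGm : MeasurableSet G) {ρ : E → ℝ≥0∞} (hρ : Measurable ρ)
    {ι : Type*} [Countable ι] (x : ι → E) {M : ℝ≥0∞} (hMt : M ≠ ⊤)
    (hM : ∀ y, ∀ g ∈ G, ρ y ≤ M * ρ (y + g)) :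
    (∑' i, ρ (x i)) * sliceVolume u s G ≤
    M * ∑' r : ℝ, ∫⁻ z : ((ℝ ∙ u)ᗮ : Submodule ℝ E),
        coverCount (fun i => x i +ᵥ G) ((z : E) + r • u) * ρ ((z : E) + r • u) := by
  rw [tsum_lintegral_coverCount_mul hu hG hGm hρ, ← ENNReal.tsum_mul_right, ← ENNReal.tsum_mul_left]
  refine ENNReal.tsum_le_tsum fun i => ?_
  rw [← lintegral_indicator_vadd hu hGm (x i), ← lintegral_const_mul' _ _ hMt]
  refine (lintegral_const_mul _ (measurable_indicator_vadd_comp _ hGm _)).symm.trans_le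
    (lintegral_mono fun z => ?_)
  · by_cases hz : (z : E) + (s + ⟪u, x i⟫_ℝ) • u ∈ x i +ᵥ G
    · simp only [indicator_of_mem hz, Pi.one_apply, one_mul, mul_one]
      obtain ⟨g, hg, hgz⟩ := hz
      rw [← hgz]
      exact hM _ g hg
    · simp [indicator_of_notMem hz]

/-- The translates of `A` by `x` tile with constant multiplicity, up to the translates of `-A` by
`y` counted negatively. -/
structure IsSignedTiling {ι κ : Type*} (A : Set E) (x : ι → E) (y : κ → E) : Prop where
  locallyFinite_left : LocallyFinite fun i => x i +ᵥ A
  locallyFinite_right : LocallyFinite fun j => y j +ᵥ -A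
  ae_coverCount : ∃ k : ℝ≥0∞, k ≠ ⊤ ∧ ∀ᵐ p : E,
    coverCount (fun i => x i +ᵥ A) p = k + coverCount (fun j => y j +ᵥ -A) p
  tsum_decayWeight : ∃ m : ℕ,
    ∑' i, decayWeight m 1 (x i) ≠ ⊤ ∧ ∑' j, decayWeight m 1 (y j) ≠ ⊤

omit [FiniteDimensional ℝ E] [MeasurableSpace E] [BorelSpace E] in
lemma vadd_polyhedron (N : Finset E) (h : E → ℝ) (x : E) :
    x +ᵥ polyhedron N h = polyhedron N fun v => h v + ⟪v, x⟫_ℝ := by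
  ext p
  simp only [mem_vadd_set_iff_neg_vadd_mem, polyhedron, mem_ofPred_eq, vadd_eq_add, inner_add_right,
    inner_neg_right]
  exact forall₂_congr fun v _ => ⟨fun h => by linarith, fun h => by linarith⟩

omit [FiniteDimensional ℝ E] [MeasurableSpace E] [BorelSpace E] in
lemma neg_polyhedron {N : Finset E} (hneg : ∀ v ∈ N, -v ∈ N) (h : E → ℝ) :
    -polyhedron N h = polyhedron N fun v => h (-v) := by
  ext p
  simp only [Set.mem_neg, polyhedron, mem_ofPred_eq, inner_neg_right]
  constructor
  · intro hp v hv
    have := hp (-v) (hneg v hv)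
    rwa [inner_neg_left, neg_neg] at this
  · intro hp v hv
    have := hp (-v) (hneg v hv)
    rwa [inner_neg_left, neg_neg] at this

omit [FiniteDimensional ℝ E] [MeasurableSpace E] [BorelSpace E] in
lemma vadd_polyhedronFace (N : Finset E) (h : E → ℝ) (u x : E) :
    x +ᵥ polyhedronFace N h u = polyhedronFace N (fun v => h v + ⟪v, x⟫_ℝ) u := by
  rw [polyhedronFace, polyhedronFace, ← vadd_polyhedron, vadd_set_inter]
  congr 1
  ext p
  simp only [mem_vadd_set_iff_neg_vadd_mem, mem_ofPred_eq, vadd_eq_add, inner_add_right,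
    inner_neg_right]
  exact ⟨fun h => by linarith, fun h => by linarith⟩

omit [FiniteDimensional ℝ E] [MeasurableSpace E] [BorelSpace E] in
lemma neg_polyhedronFace {N : Finset E} (hneg : ∀ v ∈ N, -v ∈ N) (h : E → ℝ) (u : E) :
    -polyhedronFace N h u = polyhedronFace N (fun v => h (-v)) (-u) := by
  rw [polyhedronFace, polyhedronFace, ← neg_polyhedron hneg, Set.inter_neg]
  congr 1
  ext p
  simp

lemma IsSignedTiling.coverCount_face_add_eq {ι κ : Type*} [Countable ι] [Countable κ]
    {N : Finset E} (hN : ∀ v ∈ N, ‖v‖ = 1) (hneg : ∀ v ∈ N, -v ∈ N) {h : E → ℝ} {x : ι → E}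
    {y : κ → E} (ht : IsSignedTiling (polyhedron N h) x y) {u : E} (hu : u ∈ N) (r : ℝ) :
    ∀ᵐ z : ((ℝ ∙ u)ᗮ : Submodule ℝ E),
      coverCount (fun i => x i +ᵥ polyhedronFace N h u) ((z : E) + r • u) +
        coverCount (fun j => y j +ᵥ -polyhedronFace N h u) ((z : E) + r • u) =
      coverCount (fun i => x i +ᵥ polyhedronFace N h (-u)) ((z : E) + r • u) +
        coverCount (fun j => y j +ᵥ -polyhedronFace N h (-u)) ((z : E) + r • u) := by
  obtain ⟨k, hk, hae⟩ := ht.ae_coverCount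
  have h1 := ht.locallyFinite_left
  have h2 := ht.locallyFinite_right
  simp only [neg_polyhedron hneg, vadd_polyhedron] at h1 h2 hae
  simp only [neg_polyhedronFace hneg, vadd_polyhedronFace, neg_neg]
  exact _root_.coverCount_face_add_eq hN hneg h1 h2 hk hae hu r

lemma sliceVolume_polyhedronFace {u : E} (hu : ‖u‖ = 1) (N : Finset E) (h : E → ℝ) :
    sliceVolume u (h u) (polyhedronFace N h u) = sliceVolume u (h u) (polyhedron N h) := by
  rw [sliceVolume, sliceVolume]
  congr 1
  ext z
  simp [polyhedronFace, inner_coe_add_smul hu]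

lemma IsSignedTiling.mul_sliceVolume_le {ι κ : Type*} [Countable ι] [Countable κ]
    {N : Finset E} (hN : ∀ v ∈ N, ‖v‖ = 1) (hneg : ∀ v ∈ N, -v ∈ N) {h : E → ℝ} {x : ι → E}
    {y : κ → E} (ht : IsSignedTiling (polyhedron N h) x y) {C : ℝ}
    (hC : ∀ g ∈ polyhedron N h, ‖g‖ ≤ C) (hC0 : 0 ≤ C) {u : E} (hu : u ∈ N) (m : ℕ) {ε : ℝ}
    (hε : 0 ≤ ε) :
    (∑' i, decayWeight m ε (x i) + ∑' j, decayWeight m ε (y j)) *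
        sliceVolume u (h u) (polyhedron N h) ≤
      ENNReal.ofReal (1 + ε * C) ^ m * (ENNReal.ofReal (1 + ε * C) ^ m *
        ((∑' i, decayWeight m ε (x i) + ∑' j, decayWeight m ε (y j)) *
          sliceVolume (-u) (h (-u)) (polyhedron N h))) := by
  have hu1 := hN u hu
  set M := ENNReal.ofReal (1 + ε * C) ^ m
  have hMt : M ≠ ⊤ := by finiteness
  have hface : ∀ w, MeasurableSet (polyhedronFace N h w) := fun w =>
    ((isClosed_polyhedron N h).inter
      (isClosed_eq (by fun_prop) continuous_const)).measurableSet
  have hM1 : ∀ w, ∀ g ∈ polyhedronFace N h w, ‖g‖ ≤ C := fun w g hg => hC g hg.1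
  have hM2 : ∀ w, ∀ g ∈ -polyhedronFace N h w, ‖g‖ ≤ C := fun w g hg => by
    simpa using hM1 w _ hg
  have hρ := measurable_decayWeight (E := E) m ε
  have e1 : sliceVolume u (h u) (polyhedron N h) = sliceVolume u (h u) (polyhedronFace N h u) :=
    (sliceVolume_polyhedronFace hu1 N h).symm
  have e2 : sliceVolume u (h u) (polyhedron N h) =
      sliceVolume u (-h u) (-polyhedronFace N h u) := by rw [sliceVolume_neg, e1]
  have e3 : sliceVolume (-u) (h (-u)) (polyhedron N h) =
      sliceVolume u (-h (-u)) (polyhedronFace N h (-u)) := by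
    rw [← sliceVolume_neg_left, sliceVolume_polyhedronFace (by rwa [norm_neg])]
  have e4 : sliceVolume (-u) (h (-u)) (polyhedron N h) =
      sliceVolume u (h (-u)) (-polyhedronFace N h (-u)) := by
    rw [e3, ← sliceVolume_neg, neg_neg]
  have l1 := mul_sliceVolume_le_tsum_lintegral hu1 (s := h u) (fun g hg => hg.2) (hface u) hρ x hMt
    fun y g hg => decayWeight_le_add m hε hC0 y (hM1 u g hg)
  have l2 := mul_sliceVolume_le_tsum_lintegral hu1 (s := -h u)
    (fun g hg => by have : ⟪u, -g⟫_ℝ = h u := hg.2; rw [← this, inner_neg_right, neg_neg])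
    (hface u).neg hρ y hMt fun y g hg => decayWeight_le_add m hε hC0 y (hM2 u g hg)
  have l3 := tsum_lintegral_coverCount_mul_le hu1 (s := -h (-u))
    (fun g hg => by have : ⟪-u, g⟫_ℝ = h (-u) := hg.2; rw [← this, inner_neg_left, neg_neg])
    (hface (-u)) hρ x fun y g hg => decayWeight_add_le m hε hC0 y (hM1 (-u) g hg)
  have l4 := tsum_lintegral_coverCount_mul_le hu1 (s := h (-u))
    (fun g hg => by
      have : ⟪-u, -g⟫_ℝ = h (-u) := hg.2; rw [← this, inner_neg_left, inner_neg_right, neg_neg])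
    (hface (-u)).neg hρ y fun y g hg => decayWeight_add_le m hε hC0 y (hM2 (-u) g hg)
  rw [← e1] at l1
  rw [← e2] at l2
  rw [← e3] at l3
  rw [← e4] at l4
  rw [add_mul, add_mul]
  refine (add_le_add l1 l2).trans ?_
  rw [← mul_add]
  gcongr
  rw [mul_add]
  refine Eq.trans_le ?_ (add_le_add l3 l4)
  rw [← ENNReal.tsum_add, ← ENNReal.tsum_add]
  refine tsum_congr fun r => ?_
  rw [← lintegral_add_left, ← lintegral_add_left]
  · refine lintegral_congr_ae ?_
    filter_upwards [ht.coverCount_face_add_eq hN hneg hu r] with z hz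
    rw [← add_mul, ← add_mul, hz]
  · exact measurable_coverCount_mul_comp r (hface (-u)) hρ x
  · exact measurable_coverCount_mul_comp r (hface u) hρ x

lemma IsSignedTiling.sliceVolume_le {ι κ : Type*} [Countable ι] [Countable κ] [Nonempty ι]
    {N : Finset E} (hN : ∀ v ∈ N, ‖v‖ = 1) (hneg : ∀ v ∈ N, -v ∈ N) {h : E → ℝ} {x : ι → E}
    {y : κ → E} (ht : IsSignedTiling (polyhedron N h) x y)
    (hC : Bornology.IsBounded (polyhedron N h)) {u : E} (hu : u ∈ N) :
    sliceVolume u (h u) (polyhedron N h) ≤ sliceVolume (-u) (h (-u)) (polyhedron N h) := by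
  obtain ⟨C, hC0, hC⟩ := hC.exists_pos_norm_le
  obtain ⟨m, hx, hy⟩ := ht.tsum_decayWeight
  have key : ∀ ε : ℝ, 0 < ε → ε ≤ 1 → sliceVolume u (h u) (polyhedron N h) ≤
      ENNReal.ofReal (1 + ε * C) ^ m * ENNReal.ofReal (1 + ε * C) ^ m *
        sliceVolume (-u) (h (-u)) (polyhedron N h) := by
    intro ε hε hε1
    set W := ∑' i, decayWeight m ε (x i) + ∑' j, decayWeight m ε (y j)
    have hWt : W ≠ ⊤ := ENNReal.add_ne_top.2
      ⟨tsum_decayWeight_ne_top hx hε hε1, tsum_decayWeight_ne_top hy hε hε1⟩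
    have hW0 : W ≠ 0 := by
      intro h0
      obtain ⟨i⟩ := ‹Nonempty ι›
      exact decayWeight_ne_zero m ε (x i) (ENNReal.tsum_eq_zero.1 (add_eq_zero.1 h0).1 i)
    rw [← ENNReal.mul_le_mul_iff_right hW0 hWt]
    refine (ht.mul_sliceVolume_le hN hneg hC hC0.le hu m hε.le).trans_eq ?_
    ring
  have hlim : Tendsto (fun ε : ℝ => ENNReal.ofReal (1 + ε * C) ^ m *
        ENNReal.ofReal (1 + ε * C) ^ m * sliceVolume (-u) (h (-u)) (polyhedron N h)) (𝓝[>] 0)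
      (𝓝 (1 * sliceVolume (-u) (h (-u)) (polyhedron N h))) := by
    refine ENNReal.Tendsto.mul_const ?_ (.inl one_ne_zero)
    have h1 : Tendsto (fun ε : ℝ => ENNReal.ofReal ((1 + ε * C) ^ m * (1 + ε * C) ^ m)) (𝓝[>] 0)
        (𝓝 1) := by
      have := ENNReal.tendsto_ofReal ((Continuous.tendsto (f := fun ε : ℝ =>
        (1 + ε * C) ^ m * (1 + ε * C) ^ m) (by fun_prop) 0).mono_left
          (nhdsWithin_le_nhds (s := Ioi 0)))
      simpa using this
    refine h1.congr' ?_
    filter_upwards [self_mem_nhdsWithin] with ε hε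
    have hε : 0 < ε := hε
    rw [ENNReal.ofReal_mul (by positivity), ENNReal.ofReal_pow (by positivity)]
  rw [one_mul] at hlim
  refine ge_of_tendsto hlim ?_
  filter_upwards [self_mem_nhdsWithin, Ioc_mem_nhdsGT one_pos] with ε hε hε1
  exact key ε hε hε1.2

lemma IsSignedTiling.sliceVolume_eq {ι κ : Type*} [Countable ι] [Countable κ] [Nonempty ι]
    {N : Finset E} (hN : ∀ v ∈ N, ‖v‖ = 1) (hneg : ∀ v ∈ N, -v ∈ N) {h : E → ℝ} {x : ι → E}
    {y : κ → E} (ht : IsSignedTiling (polyhedron N h) x y)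
    (hC : Bornology.IsBounded (polyhedron N h)) {u : E} (hu : u ∈ N) :
    sliceVolume u (h u) (polyhedron N h) = sliceVolume (-u) (h (-u)) (polyhedron N h) := by
  refine (ht.sliceVolume_le hN hneg hC hu).antisymm ?_
  simpa only [neg_neg] using ht.sliceVolume_le hN hneg hC (hneg u hu)

end

section

variable {E : Type*} [NormedAddCommGroup E] [InnerProductSpace ℝ E] [FiniteDimensional ℝ E]
    [MeasurableSpace E] [BorelSpace E]

/-- A finite intersection of closed half-spaces. -/
def IsPolyhedral {E : Type*} [NormedAddCommGroup E] [InnerProductSpace ℝ E] (A : Set E) : Prop :=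
  ∃ s : Finset (E × ℝ), A = {x | ∀ p ∈ s, ⟪p.1, x⟫_ℝ ≤ p.2}

omit [FiniteDimensional ℝ E] [MeasurableSpace E] [BorelSpace E] in
lemma IsPolyhedral.vadd {A : Set E} (hA : IsPolyhedral A) (a : E) : IsPolyhedral (a +ᵥ A) := by
  classical
  obtain ⟨s, rfl⟩ := hA
  refine ⟨s.image fun p => (p.1, p.2 + ⟪p.1, a⟫_ℝ), ?_⟩
  ext x
  simp only [mem_vadd_set_iff_neg_vadd_mem, mem_ofPred_eq, Finset.forall_mem_image, vadd_eq_add,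
    inner_add_right, inner_neg_right]
  exact forall₂_congr fun p _ => ⟨fun h => by linarith, fun h => by linarith⟩

omit [FiniteDimensional ℝ E] [MeasurableSpace E] [BorelSpace E] in
lemma IsPolyhedral.exists_eq_polyhedron {A : Set E} (hA : IsPolyhedral A) (hc : IsCompact A)
    (hne : A.Nonempty) {T : Finset E} (hT : ∀ v ∈ T, ‖v‖ = 1) :
    ∃ (N : Finset E) (h : E → ℝ), (∀ v ∈ N, ‖v‖ = 1) ∧ (∀ v ∈ N, -v ∈ N) ∧ T ⊆ N ∧
      (∀ v ∈ N, ∃ x ∈ A, ⟪v, x⟫_ℝ = h v) ∧ A = polyhedron N h := by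
  classical
  obtain ⟨s, hs⟩ := hA
  obtain ⟨a, ha⟩ := hne
  set N₀ : Finset E := T ∪ (s.filter fun p => p.1 ≠ 0).image fun p => ‖p.1‖⁻¹ • p.1
  have hN₀ : ∀ v ∈ N₀, ‖v‖ = 1 := by
    intro v hv
    rcases Finset.mem_union.1 hv with hv | hv
    · exact hT v hv
    obtain ⟨p, hp, rfl⟩ := Finset.mem_image.1 hv
    rw [norm_smul, norm_inv, norm_norm,
      inv_mul_cancel₀ (norm_ne_zero_iff.2 (Finset.mem_filter.1 hp).2)]
  have hcv : ∀ v : E, IsCompact ((fun x => ⟪v, x⟫_ℝ) '' A) := fun v => hc.image (by fun_prop)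
  refine ⟨N₀ ∪ N₀.image (- ·), fun v => sSup ((fun x => ⟪v, x⟫_ℝ) '' A), ?_, ?_,
    Finset.subset_union_left.trans Finset.subset_union_left,
    fun v _ => (hcv v).sSup_mem ⟨_, mem_image_of_mem _ ha⟩, ?_⟩
  · intro v hv
    rcases Finset.mem_union.1 hv with hv | hv
    · exact hN₀ v hv
    · obtain ⟨w, hw, rfl⟩ := Finset.mem_image.1 hv
      rw [norm_neg, hN₀ w hw]
  · intro v hv
    rcases Finset.mem_union.1 hv with hv | hv
    · exact Finset.mem_union_right _ (Finset.mem_image_of_mem _ hv)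
    · obtain ⟨w, hw, rfl⟩ := Finset.mem_image.1 hv
      rw [neg_neg]
      exact Finset.mem_union_left _ hw
  · refine Subset.antisymm (fun x hx v _ => le_csSup (hcv v).bddAbove (mem_image_of_mem _ hx)) ?_
    intro x hx
    rw [hs]
    intro p hp
    by_cases hp0 : p.1 = 0
    · have : ⟪p.1, a⟫_ℝ ≤ p.2 := by rw [hs] at ha; exact ha p hp
      rw [hp0, inner_zero_left] at this ⊢
      exact this
    · have hpos : 0 < ‖p.1‖ := norm_pos_iff.2 hp0
      have h1 : ⟪‖p.1‖⁻¹ • p.1, x⟫_ℝ ≤ ‖p.1‖⁻¹ * p.2 := by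
        refine (hx _ (Finset.mem_union_left _ (Finset.mem_union_right _ (Finset.mem_image_of_mem _
          (Finset.mem_filter.2 ⟨hp, hp0⟩))))).trans (csSup_le ⟨_, mem_image_of_mem _ ha⟩ ?_)
        rintro _ ⟨y, hy, rfl⟩
        rw [hs] at hy
        change ⟪‖p.1‖⁻¹ • p.1, y⟫_ℝ ≤ _
        rw [real_inner_smul_left]
        exact mul_le_mul_of_nonneg_left (hy p hp) (by positivity)
      rw [real_inner_smul_left] at h1
      exact le_of_mul_le_mul_left h1 (by positivity)

omit [FiniteDimensional ℝ E] [MeasurableSpace E] [BorelSpace E] in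
lemma pos_of_zero_mem_interior_polyhedron {N : Finset E} {h : E → ℝ} (hN : ∀ v ∈ N, ‖v‖ = 1)
    (h0 : (0 : E) ∈ interior (polyhedron N h)) : ∀ v ∈ N, 0 < h v := by
  intro v hv
  obtain ⟨δ, hδ, hball⟩ := Metric.mem_nhds_iff.1 (mem_interior_iff_mem_nhds.1 h0)
  have hmem : (δ / 2) • v ∈ polyhedron N h := hball (by
    rw [mem_ball_zero_iff, norm_smul, hN v hv, mul_one, Real.norm_eq_abs,
      abs_of_pos (by positivity)]
    linarith)
  refine lt_of_lt_of_le ?_ (hmem v hv)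
  rw [inner_smul_right, real_inner_self_eq_norm_sq, hN v hv]
  positivity

omit [InnerProductSpace ℝ E] [FiniteDimensional ℝ E] [MeasurableSpace E] [BorelSpace E] in
lemma tsum_decayWeight_add_ne_top {m : ℕ} {ι : Type*} {x : ι → E}
    (hx : ∑' i, decayWeight m 1 (x i) ≠ ⊤) {g : ι → E} {C : ℝ} (hg : ∀ i, ‖g i‖ ≤ C) (hC : 0 ≤ C) :
    ∑' i, decayWeight m 1 (x i + g i) ≠ ⊤ := by
  refine ne_top_of_le_ne_top (b := ENNReal.ofReal (1 + 1 * C) ^ m * ∑' i, decayWeight m 1 (x i))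
    (by finiteness) ?_
  rw [← ENNReal.tsum_mul_left]
  exact ENNReal.tsum_le_tsum fun i => decayWeight_add_le m zero_le_one hC (x i) (hg i)

lemma IsSignedTiling.vadd {ι κ : Type*} {A : Set E} {x : ι → E} {y : κ → E}
    (ht : IsSignedTiling A x y) (a : E) :
    IsSignedTiling (a +ᵥ A) (fun i => x i + -a) (fun j => y j + a) := by
  have h1 : ∀ i, (x i + -a) +ᵥ (a +ᵥ A) = x i +ᵥ A := fun i => by
    rw [vadd_vadd, neg_add_cancel_right]
  have h2 : ∀ j, (y j + a) +ᵥ -(a +ᵥ A) = y j +ᵥ -A := fun j => by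
    ext p
    simp only [mem_vadd_set_iff_neg_vadd_mem, Set.mem_neg, vadd_eq_add]
    rw [iff_iff_eq]
    congr 1
    abel
  obtain ⟨m, hx, hy⟩ := ht.tsum_decayWeight
  refine ⟨?_, ?_, ?_, m, tsum_decayWeight_add_ne_top hx (fun _ => le_rfl) (norm_nonneg _),
    tsum_decayWeight_add_ne_top hy (fun _ => le_rfl) (norm_nonneg _)⟩
  · simpa only [h1] using ht.locallyFinite_left
  · simpa only [h2] using ht.locallyFinite_right
  · simpa only [h1, h2] using ht.ae_coverCount

/-- A polyhedral convex body admitting a signed tiling is centrally symmetric. -/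
theorem IsSignedTiling.exists_center {ι κ : Type*} [Countable ι] [Countable κ] [Nonempty ι]
    {A : Set E} {x : ι → E} {y : κ → E} (ht : IsSignedTiling A x y) (hA : IsPolyhedral A)
    (hc : IsCompact A) (hconv : Convex ℝ A) (hi : (interior A).Nonempty) :
    ∃ c : E, (fun y => (2 : ℝ) • c - y) '' A = A := by
  obtain ⟨a, ha⟩ := hi
  have h0 : (0 : E) ∈ interior (-a +ᵥ A) := by
    rw [interior_vadd, mem_vadd_set_iff_neg_vadd_mem]
    simpa using ha
  obtain ⟨N, h, hN, hneg, -, -, hEq⟩ := (hA.vadd (-a)).exists_eq_polyhedron (hc.vadd (-a))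
    ⟨0, interior_subset h0⟩ (T := ∅) (by simp)
  have hpos := pos_of_zero_mem_interior_polyhedron hN (hEq ▸ h0)
  have ht' := ht.vadd (-a)
  have hc' := hc.vadd (-a)
  rw [hEq] at ht' hc'
  have hv : volume (polyhedron N h) ≠ 0 := by
    rw [← hEq]
    exact (Measure.measure_pos_of_nonempty_interior volume ⟨0, h0⟩).ne'
  have hfo := volume_polyhedron_first_order hN hneg hpos hc' hv
    fun u hu => ht'.sliceVolume_eq hN hneg hc'.isBounded hu
  rw [← hEq] at hfo hc'
  have hconv' : Convex ℝ (-a +ᵥ A) := hconv.vadd (-a)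
  obtain ⟨c, hcc⟩ := exists_center_of_volume_midpoint_le hc' hconv' ⟨0, h0⟩
    (volume_midpoint_le_of_first_order hc' hconv' ⟨0, h0⟩ hfo)
  refine ⟨c + a, ?_⟩
  have key : ∀ p ∈ A, (2 : ℝ) • (c + a) - p ∈ A := by
    intro p hp
    have : (2 : ℝ) • c - (-a + p) ∈ -a +ᵥ A := by
      rw [← hcc]
      exact mem_image_of_mem _ (vadd_mem_vadd_set hp)
    rw [mem_vadd_set_iff_neg_vadd_mem, neg_neg, vadd_eq_add] at this
    convert this using 1
    module
  refine Subset.antisymm (image_subset_iff.2 key) fun p hp => ⟨_, key p hp, ?_⟩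
  simp

end

section

variable {E : Type*} [NormedAddCommGroup E] [InnerProductSpace ℝ E] [FiniteDimensional ℝ E]

/-- The radial projection from `y` onto the boundary of `K`. -/
noncomputable def radialProj {E : Type*} [AddCommGroup E] [Module ℝ E] (K : Set E) (y q : E) : E :=
  y + (gauge (-y +ᵥ K) (q - y))⁻¹ • (q - y)

omit [InnerProductSpace ℝ E] [FiniteDimensional ℝ E] in
lemma vadd_mem_nhds_zero {K : Set E} {y : E} (hy : y ∈ interior K) : -y +ᵥ K ∈ 𝓝 (0 : E) := by
  rw [← mem_interior_iff_mem_nhds, interior_vadd, mem_vadd_set_iff_neg_vadd_mem]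
  simpa using hy

omit [FiniteDimensional ℝ E] in
lemma gauge_eq_one_iff_of_mem_interior {K : Set E} (hc : Convex ℝ K) {y : E}
    (hy : y ∈ interior K) (q : E) : gauge (-y +ᵥ K) (q - y) = 1 ↔ q ∈ frontier K := by
  have h : frontier (-y +ᵥ K) = -y +ᵥ frontier K :=
    ((Homeomorph.addLeft (-y)).image_frontier K).symm
  rw [gauge_eq_one_iff_mem_frontier (hc.vadd _) (vadd_mem_nhds_zero hy), h,
    mem_vadd_set_iff_neg_vadd_mem]
  simp

omit [FiniteDimensional ℝ E] in
lemma gauge_lt_one_iff_of_mem_interior {K : Set E} (hc : Convex ℝ K) {y : E}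
    (hy : y ∈ interior K) (q : E) : gauge (-y +ᵥ K) (q - y) < 1 ↔ q ∈ interior K := by
  rw [gauge_lt_one_iff_mem_interior (hc.vadd _) (vadd_mem_nhds_zero hy), interior_vadd,
    mem_vadd_set_iff_neg_vadd_mem]
  simp

omit [FiniteDimensional ℝ E] in
lemma radialProj_mem_frontier {K : Set E} (hc : Convex ℝ K) {y : E}
    (hy : y ∈ interior K) {q : E} (hq : gauge (-y +ᵥ K) (q - y) ≠ 0) :
    radialProj K y q ∈ frontier K := by
  rw [← gauge_eq_one_iff_of_mem_interior hc hy, radialProj, add_sub_cancel_left,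
    gauge_smul_of_nonneg (inv_nonneg.2 (gauge_nonneg _)), smul_eq_mul, inv_mul_cancel₀ hq]

omit [FiniteDimensional ℝ E] in
lemma tendsto_radialProj {K : Set E} (hc : Convex ℝ K) {y p : E} (hy : y ∈ interior K)
    (hp : p ∈ frontier K) : Tendsto (radialProj K y) (𝓝 p) (𝓝 p) := by
  have h1 := (gauge_eq_one_iff_of_mem_interior hc hy p).2 hp
  have hg : Continuous (gauge (-y +ᵥ K)) := continuous_gauge (hc.vadd _) (vadd_mem_nhds_zero hy)
  have h2 : ContinuousAt (radialProj K y) p := by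
    unfold radialProj
    refine continuousAt_const.add (ContinuousAt.smul (ContinuousAt.inv₀ ?_ ?_) ?_)
    · exact (hg.comp (continuous_id.sub continuous_const)).continuousAt
    · rw [h1]; exact one_ne_zero
    · exact (continuous_id.sub continuous_const).continuousAt
  have h3 : radialProj K y p = p := by rw [radialProj, h1]; simp
  simpa only [ContinuousAt, h3] using h2

omit [FiniteDimensional ℝ E] in
/-- If `L` contains a relatively open piece of the boundary of `K`, near which `L` does not
contain the interior of `K`, then `L` does not meet the interior of `K`. -/
lemma disjoint_interior_of_eventually_mem {K L : Set E} (hK : Convex ℝ K) (hL : Convex ℝ L)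
    {p : E} (hp : p ∈ frontier K) (hpL : ∀ᶠ q in 𝓝 p, q ∈ frontier K → q ∈ L)
    (hcl : p ∈ closure (interior K \ L)) : Disjoint (interior K) L := by
  rw [Set.disjoint_left]
  intro y hyK hyL
  have hg : Continuous (gauge (-y +ᵥ K)) := continuous_gauge (hK.vadd _) (vadd_mem_nhds_zero hyK)
  have h1 : ∀ᶠ q in 𝓝 p, gauge (-y +ᵥ K) (q - y) ≠ 0 := by
    refine ((hg.comp (continuous_id.sub continuous_const)).tendsto p).eventually_ne ?_
    have := (gauge_eq_one_iff_of_mem_interior hK hyK p).2 hp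
    simp [this]
  obtain ⟨q, ⟨hq1, hq2⟩, hqK, hqL⟩ :=
    ((mem_closure_iff_frequently.1 hcl).and_eventually
      (h1.and ((tendsto_radialProj hK hyK hp).eventually hpL))).exists.imp
      fun q hq => And.intro hq.2 hq.1
  have h3 := hq2 (radialProj_mem_frontier hK hyK hq1)
  have h4 : gauge (-y +ᵥ K) (q - y) ≤ 1 := ((gauge_lt_one_iff_of_mem_interior hK hyK q).2 hqK).le
  apply hqL
  have h5 := hL hyL h3 (sub_nonneg.2 h4) (gauge_nonneg _) (sub_add_cancel _ _)
  convert h5 using 1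
  rw [radialProj, smul_add, smul_smul, mul_inv_cancel₀ hq1, ← add_assoc, ← add_smul]
  simp

lemma coverCount_add_one_le {α ι : Type*} {P : ι → Set α} {p q : α} (h : ∀ i, p ∈ P i → q ∈ P i)
    {i : ι} (hp : p ∉ P i) (hq : q ∈ P i) : coverCount P p + 1 ≤ coverCount P q := by
  classical
  rw [coverCount, coverCount, ← tsum_ite_eq i (fun _ => (1 : ℝ≥0∞)), ← ENNReal.tsum_add]
  refine ENNReal.tsum_le_tsum fun j => ?_
  by_cases hj : j = i
  · subst hj
    simp [hp, hq]
  · rw [if_neg hj, add_zero]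
    by_cases hpj : p ∈ P j
    · simp [hpj, h j hpj]
    · simp [hpj]

omit [FiniteDimensional ℝ E] in
lemma exists_mem_closure_interior_diff {ι : Type*} {P : ι → Set E} (hP : LocallyFinite P)
    (hcl : ∀ i, IsClosed (P i)) {k : ℝ≥0∞} (hk : k ≠ ⊤) (hD : Dense {p | coverCount P p = k})
    {i₀ : ι} (hc : Convex ℝ (P i₀)) (hi : (interior (P i₀)).Nonempty) {p : E}
    (hp : p ∈ frontier (P i₀)) : ∃ i, p ∈ P i ∩ closure (interior (P i₀) \ P i) := by
  by_contra! hcon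
  have hpm : p ∈ P i₀ := (hcl i₀).frontier_subset hp
  have h1 : ∀ᶠ q in 𝓝 p, ∀ i ∈ {i | p ∈ P i}, q ∈ interior (P i₀) → q ∈ P i := by
    refine (Filter.eventually_all_finite (hP.point_finite p)).2 fun i hi => ?_
    have h2 : p ∉ closure (interior (P i₀) \ P i) := fun h => hcon i ⟨hi, h⟩
    rw [mem_closure_iff_frequently, not_frequently] at h2
    exact h2.mono fun q hq hq' => by_contra fun h => hq ⟨hq', h⟩
  obtain ⟨U, hU, hUo, hpU⟩ := eventually_nhds_iff.1 (h1.and (hP.eventually_subset hcl p))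
  have hpc : p ∈ closure (interior (P i₀)) := by
    rw [hc.closure_interior_eq_closure_of_nonempty_interior hi]
    exact subset_closure hpm
  obtain ⟨q, hqD, hq⟩ := hD.exists_mem_open (hUo.inter isOpen_interior)
    (mem_closure_iff.1 hpc U hUo hpU)
  have hpc' : p ∈ closure (P i₀)ᶜ := by
    rw [frontier_eq_closure_inter_closure] at hp
    exact hp.2
  obtain ⟨q', hqD', hq'⟩ := hD.exists_mem_open (hUo.inter (hcl i₀).isOpen_compl)
    (mem_closure_iff.1 hpc' U hUo hpU)
  have h3 := coverCount_add_one_le (P := P) (p := q') (q := q) (i := i₀)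
    (fun i hi => (hU q hq.1).1 i ((hU q' hq'.1).2 hi) hq.2) hq'.2 (interior_subset hq.2)
  rw [hqD, hqD'] at h3
  exact (ENNReal.lt_add_right hk one_ne_zero).not_ge h3

omit [FiniteDimensional ℝ E] in
lemma exists_mem_disjoint_interior {ι : Type*} {P : ι → Set E} (hP : LocallyFinite P)
    (hcl : ∀ i, IsClosed (P i)) {k : ℝ≥0∞} (hk : k ≠ ⊤) (hD : Dense {p | coverCount P p = k})
    (hc : ∀ i, Convex ℝ (P i)) {i₀ : ι} (hi : (interior (P i₀)).Nonempty) {p : E}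
    (hp : p ∈ frontier (P i₀)) : ∃ i, p ∈ P i ∧ Disjoint (interior (P i₀)) (P i) := by
  by_contra! hcon
  set D : ι → Set E := fun i => P i ∩ closure (interior (P i₀) \ P i)
  have hDlf : LocallyFinite D := hP.subset fun i => inter_subset_left
  have hDcl : ∀ i, IsClosed (D i) := fun i => (hcl i).inter isClosed_closure
  obtain ⟨U, hU, hUo, hpU⟩ := eventually_nhds_iff.1 (hP.eventually_subset hcl p)
  have hne : (frontier (P i₀) ∩ U).Nonempty := ⟨p, hp, hpU⟩
  obtain ⟨p', ⟨hp', hpU'⟩, hmin⟩ := exists_minimalFor_of_wellFoundedLT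
    (fun q => q ∈ frontier (P i₀) ∩ U) (fun q => {i | q ∈ D i}.ncard) hne
  obtain ⟨i, hi'⟩ := exists_mem_closure_interior_diff hP hcl hk hD (hc i₀) hi hp'
  refine hcon i (hU p' hpU' hi'.1) (disjoint_interior_of_eventually_mem (hc i₀) (hc i) hp' ?_ hi'.2)
  filter_upwards [hDlf.eventually_subset hDcl p', hUo.mem_nhds hpU'] with q hq hqU hqf
  have h1 : {i | q ∈ D i} = {i | p' ∈ D i} := by
    refine Set.eq_of_subset_of_ncard_le hq ?_ (hDlf.point_finite p')
    exact hmin ⟨hqf, hqU⟩ (Set.ncard_le_ncard hq (hDlf.point_finite p'))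
  have h2 : i ∈ {i | q ∈ D i} := by rw [h1]; exact hi'
  exact h2.1

/-- A compact member of a locally finite multiple tiling by closed convex sets is polyhedral. -/
theorem isPolyhedral_of_coverCount_eq {ι : Type*} {P : ι → Set E} (hP : LocallyFinite P)
    (hcl : ∀ i, IsClosed (P i)) {k : ℝ≥0∞} (hk : k ≠ ⊤) (hD : Dense {p | coverCount P p = k})
    (hc : ∀ i, Convex ℝ (P i)) {i₀ : ι} (hi : (interior (P i₀)).Nonempty)
    (hcpt : IsCompact (P i₀)) : IsPolyhedral (P i₀) := by
  classical
  have hfin : {i | (P i ∩ P i₀).Nonempty}.Finite := hP.finite_nonempty_inter_compact hcpt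
  have hsep : ∀ i, ∃ q : E × ℝ, Disjoint (interior (P i₀)) (P i) →
      (∀ a ∈ interior (P i₀), ⟪q.1, a⟫_ℝ < q.2) ∧ ∀ b ∈ P i, q.2 ≤ ⟪q.1, b⟫_ℝ := by
    intro i
    by_cases hdis : Disjoint (interior (P i₀)) (P i)
    · obtain ⟨f, s, h1, h2⟩ :=
        geometric_hahn_banach_open (hc i₀).interior isOpen_interior (hc i) hdis
      refine ⟨((InnerProductSpace.toDual ℝ E).symm f, s), fun _ => ⟨?_, ?_⟩⟩
      · simpa using h1
      · simpa using h2
    · exact ⟨0, fun h => (hdis h).elim⟩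
  choose q hq using hsep
  refine ⟨(hfin.toFinset.filter fun i => Disjoint (interior (P i₀)) (P i)).image q, ?_⟩
  ext x
  simp only [mem_ofPred_eq, Finset.forall_mem_image, Finset.mem_filter, Finite.mem_toFinset]
  constructor
  · rintro hx i ⟨-, hi'⟩
    have : P i₀ ⊆ {x | ⟪(q i).1, x⟫_ℝ ≤ (q i).2} := by
      rw [← (hcl i₀).closure_eq,
        ← (hc i₀).closure_interior_eq_closure_of_nonempty_interior hi]
      exact closure_minimal (fun a ha => ((hq i hi').1 a ha).le)
        (isClosed_le (by fun_prop) continuous_const)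
    exact this hx
  · intro hx
    by_contra hxK
    obtain ⟨y, hy⟩ := hi
    have hg1 : 1 < gauge (-y +ᵥ P i₀) (x - y) := by
      by_contra! hle
      rcases hle.lt_or_eq with h | h
      · exact hxK (interior_subset ((gauge_lt_one_iff_of_mem_interior (hc i₀) hy x).1 h))
      · exact hxK ((hcl i₀).frontier_subset
          ((gauge_eq_one_iff_of_mem_interior (hc i₀) hy x).1 h))
    have hfr := radialProj_mem_frontier (hc i₀) hy (zero_lt_one.trans hg1).ne'
    obtain ⟨i, hiP, hdis⟩ := exists_mem_disjoint_interior hP hcl hk hD hc ⟨y, hy⟩ hfr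
    have h1 := (hq i hdis).1 y hy
    have h2 := (hq i hdis).2 _ hiP
    have h3 := hx ⟨⟨_, hiP, (hcl i₀).frontier_subset hfr⟩, hdis⟩
    rw [radialProj, inner_add_right, inner_smul_right, inner_sub_right] at h2
    have hinv1 : (gauge (-y +ᵥ P i₀) (x - y))⁻¹ < 1 := inv_lt_one_of_one_lt₀ hg1
    have hinv0 : 0 < (gauge (-y +ᵥ P i₀) (x - y))⁻¹ := inv_pos.2 (zero_lt_one.trans hg1)
    nlinarith

end

section

variable {E : Type*} [NormedAddCommGroup E] [InnerProductSpace ℝ E] [FiniteDimensional ℝ E]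
    [MeasurableSpace E] [BorelSpace E]

omit [FiniteDimensional ℝ E] [MeasurableSpace E] [BorelSpace E] in
lemma IsPolyhedral.finite_extremePoints {A : Set E} (hA : IsPolyhedral A) :
    (A.extremePoints ℝ).Finite := by
  classical
  obtain ⟨s, rfl⟩ := hA
  refine Set.Finite.of_injOn (f := fun x => s.filter fun p => ⟪p.1, x⟫_ℝ = p.2)
    (t := (s.powerset : Set (Finset (E × ℝ))))
    (fun x _ => Finset.mem_coe.2 (Finset.mem_powerset.2 (Finset.filter_subset _ _))) ?_
    (Finset.finite_toSet _)
  intro x hx y hy hxy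
  have hxy : (s.filter fun p => ⟪p.1, x⟫_ℝ = p.2) = s.filter fun p => ⟪p.1, y⟫_ℝ = p.2 := hxy
  have hact : ∀ p ∈ s, ⟪p.1, x⟫_ℝ = p.2 → ⟪p.1, y⟫_ℝ = p.2 := fun p hp h =>
    (Finset.mem_filter.1 (hxy ▸ Finset.mem_filter.2 ⟨hp, h⟩ :
      p ∈ s.filter fun p => ⟪p.1, y⟫_ℝ = p.2)).2
  have hev : ∀ᶠ t in 𝓝[>] (0 : ℝ), ∀ p ∈ s, ⟪p.1, x - t • (y - x)⟫_ℝ ≤ p.2 := by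
    refine (Filter.eventually_all_finset s).2 fun p hp => ?_
    rcases (hx.1 p hp).lt_or_eq with h | h
    · have h1 : Tendsto (fun t : ℝ => ⟪p.1, x - t • (y - x)⟫_ℝ) (𝓝[>] 0)
          (𝓝 ⟪p.1, x - (0 : ℝ) • (y - x)⟫_ℝ) :=
        (Continuous.tendsto (by fun_prop) 0).mono_left nhdsWithin_le_nhds
      rw [zero_smul, sub_zero] at h1
      exact (h1.eventually_lt_const h).mono fun t ht => ht.le
    · refine .of_forall fun t => ?_
      rw [inner_sub_right, inner_smul_right, inner_sub_right, h, hact p hp h]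
      simp
  obtain ⟨t, ht, ht0⟩ := (hev.and self_mem_nhdsWithin).exists
  have ht0 : 0 < t := ht0
  have hseg : x ∈ openSegment ℝ (x - t • (y - x)) y := by
    refine ⟨(1 + t)⁻¹, t * (1 + t)⁻¹, by positivity, by positivity, by field_simp, ?_⟩
    have : (1 + t)⁻¹ + t * (1 + t)⁻¹ = 1 := by field_simp
    calc (1 + t)⁻¹ • (x - t • (y - x)) + (t * (1 + t)⁻¹) • y
        = ((1 + t)⁻¹ + t * (1 + t)⁻¹) • x := by module
      _ = x := by rw [this, one_smul]
  exact ((mem_extremePoints.1 hx).2 _ ht _ hy.1 hseg).2.symm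

omit [FiniteDimensional ℝ E] [MeasurableSpace E] [BorelSpace E] in
/-- A compact finite intersection of half-spaces is the convex hull of finitely many points. -/
lemma IsPolyhedral.exists_eq_convexHull {A : Set E} (hA : IsPolyhedral A) (hc : IsCompact A)
    (hconv : Convex ℝ A) : ∃ V : Finset E, A = convexHull ℝ (V : Set E) := by
  refine ⟨hA.finite_extremePoints.toFinset, ?_⟩
  have h := closure_convexHull_extremePoints hc hconv
  rw [IsClosed.closure_eq (hA.finite_extremePoints.isCompact_convexHull ℝ).isClosed] at h
  rw [Finite.coe_toFinset, h]

lemma coverCount_eq_encard {α ι : Type*} (P : ι → Set α) (p : α) :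
    coverCount P p = ({i | p ∈ P i}.encard : ℝ≥0∞) := by
  rw [← ENNReal.tsum_set_one, tsum_subtype {i | p ∈ P i} (fun _ => (1 : ℝ≥0∞)), coverCount]
  refine tsum_congr fun i => ?_
  by_cases h : p ∈ P i <;> simp [h]

lemma lintegral_decayWeight_lt_top :
    ∫⁻ x : E, decayWeight (Module.finrank ℝ E + 1) 1 x < ⊤ := by
  have h := finite_integral_one_add_norm (E := E) (μ := volume)
    (r := ((Module.finrank ℝ E + 1 : ℕ) : ℝ)) (by push_cast; linarith)
  refine (lintegral_congr fun x => ?_).trans_lt h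
  rw [Real.rpow_neg (by positivity), Real.rpow_natCast, ENNReal.ofReal_inv_of_pos (by positivity),
    ENNReal.ofReal_pow (by positivity), decayWeight, one_mul]

lemma tsum_decayWeight_ne_top_of_coverCount {A : Set E} (hc : IsCompact A)
    (hA : volume A ≠ 0) {ι : Type*} [Countable ι] {x : ι → E} {k : ℝ≥0∞} (hk : k ≠ ⊤)
    (hae : ∀ᵐ p : E, coverCount (fun i => x i +ᵥ A) p = k) :
    ∑' i, decayWeight (Module.finrank ℝ E + 1) 1 (x i) ≠ ⊤ := by
  set m := Module.finrank ℝ E + 1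
  obtain ⟨C, hC0, hC⟩ := hc.isBounded.exists_pos_norm_le
  set M := ENNReal.ofReal (1 + 1 * C) ^ m
  have hMt : M ≠ ⊤ := by finiteness
  have hρ : Measurable (decayWeight m 1 : E → ℝ≥0∞) := measurable_decayWeight m 1
  have hmeas : ∀ i, MeasurableSet (x i +ᵥ A) := fun i => hc.measurableSet.const_vadd _
  have h1 : (∑' i, decayWeight m 1 (x i)) * volume A ≤
      M * (k * ∫⁻ p : E, decayWeight m 1 p) := by
    calc (∑' i, decayWeight m 1 (x i)) * volume A
        ≤ ∑' i, M * ∫⁻ p in x i +ᵥ A, decayWeight m 1 p := by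
          rw [← ENNReal.tsum_mul_right]
          refine ENNReal.tsum_le_tsum fun i => ?_
          rw [← lintegral_const_mul _ hρ, ← measure_vadd volume (x i) A, ← setLIntegral_const]
          refine setLIntegral_mono (hρ.const_mul _) ?_
          rintro _ ⟨g, hg, rfl⟩
          exact decayWeight_le_add m zero_le_one hC0.le (x i) (hC g hg)
      _ = M * ∫⁻ p, coverCount (fun i => x i +ᵥ A) p * decayWeight m 1 p := by
          rw [ENNReal.tsum_mul_left]
          congr 1
          simp_rw [coverCount, ← ENNReal.tsum_mul_right]
          rw [lintegral_tsum]
          swap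
          · exact fun i => ((measurable_one.indicator (hmeas i)).mul hρ).aemeasurable
          refine tsum_congr fun i => ?_
          rw [← lintegral_indicator (hmeas i)]
          refine lintegral_congr fun p => ?_
          by_cases hp : p ∈ x i +ᵥ A <;> simp [hp]
      _ = M * (k * ∫⁻ p : E, decayWeight m 1 p) := by
          rw [← lintegral_const_mul _ hρ]
          congr 1
          refine lintegral_congr_ae ?_
          filter_upwards [hae] with p hp
          rw [hp]
  intro htop
  rw [htop, ENNReal.top_mul hA, top_le_iff] at h1
  exact ENNReal.mul_ne_top hMt (ENNReal.mul_ne_top hk lintegral_decayWeight_lt_top.ne) h1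

lemma isSignedTiling_of_coverCount {A : Set E} (hc : IsCompact A)
    (hA : volume A ≠ 0) {ι κ : Type*} [Countable ι] [IsEmpty κ] {x : ι → E} {k : ℝ≥0∞} (hk : k ≠ ⊤)
    (hloc : LocallyFinite fun i => x i +ᵥ A)
    (hae : ∀ᵐ p : E, coverCount (fun i => x i +ᵥ A) p = k) (y : κ → E) :
    IsSignedTiling A x y := by
  refine ⟨hloc, locallyFinite_of_finite _, ⟨k, hk, ?_⟩, _,
    tsum_decayWeight_ne_top_of_coverCount hc hA hk hae, by simp⟩
  filter_upwards [hae] with p hp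
  rw [hp, coverCount, tsum_empty, add_zero]

end

section

variable {E : Type*} [NormedAddCommGroup E] [InnerProductSpace ℝ E] [FiniteDimensional ℝ E]
    [MeasurableSpace E] [BorelSpace E]

lemma coverCount_subtype {α ι : Type*} {P : ι → Set α} {s : ι → Prop} {q : α}
    (h : ∀ i, q ∈ P i → s i) : coverCount (fun i : {i // s i} => P i) q = coverCount P q := by
  refine tsum_subtype_eq_of_support_subset (s := {i | s i}) (f := fun i => (P i).indicator 1 q) ?_
  intro i hi
  exact h i (by_contra fun hq => hi (indicator_of_notMem hq _))

omit [FiniteDimensional ℝ E] [MeasurableSpace E] [BorelSpace E] in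
lemma IsPolyhedral.slice {A : Set E} (hA : IsPolyhedral A) (V : Submodule ℝ E)
    [V.HasOrthogonalProjection] (a : E) : IsPolyhedral {z : V | (z : E) + a ∈ A} := by
  classical
  obtain ⟨s, rfl⟩ := hA
  refine ⟨s.image fun p => (V.orthogonalProjectionOnto p.1, p.2 - ⟪p.1, a⟫_ℝ), ?_⟩
  ext z
  simp only [mem_ofPred_eq, Finset.forall_mem_image, inner_add_right]
  refine forall₂_congr fun p _ => ?_
  rw [Submodule.inner_orthogonalProjectionOnto_eq_of_mem_right]
  exact le_sub_iff_add_le.symm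

omit [MeasurableSpace E] [BorelSpace E] in
lemma interior_nonempty_of_finrank_direction {V : Submodule ℝ E} {A : Set V}
    (hconv : Convex ℝ A) (hne : A.Nonempty) (a : E)
    (hd : Module.finrank ℝ (affineSpan ℝ ((fun z : V => (z : E) + a) '' A)).direction =
      Module.finrank ℝ V) : (interior A).Nonempty := by
  set φ : V →ᵃ[ℝ] E := V.subtype.toAffineMap + AffineMap.const ℝ V a
  have hφ : (fun z : V => (z : E) + a) = φ := by ext z; simp [φ]
  rw [hφ, ← AffineSubspace.map_span, AffineSubspace.map_direction] at hd
  have hlin : φ.linear = V.subtype := by ext z; simp [φ]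
  rw [hlin, Submodule.finrank_map_subtype_eq] at hd
  rw [hconv.interior_nonempty_iff_affineSpan_eq_top,
    ← AffineSubspace.direction_eq_top_iff_of_nonempty ((affineSpan_nonempty ℝ).2 hne)]
  exact Submodule.eq_top_of_finrank_eq hd

omit [FiniteDimensional ℝ E] [MeasurableSpace E] [BorelSpace E] in
lemma mem_polyhedronFace_neg_iff {N : Finset E} {h : E → ℝ} {c : E} {u : E} (hu : u ∈ N)
    (hu' : -u ∈ N) (hc : ∀ p ∈ polyhedron N h, (2 : ℝ) • c - p ∈ polyhedron N h)
    (hatt : ∀ v ∈ N, ∃ x ∈ polyhedron N h, ⟪v, x⟫_ℝ = h v) (p : E) :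
    p ∈ polyhedronFace N h (-u) ↔ (2 : ℝ) • c - p ∈ polyhedronFace N h u := by
  have hsum : h (-u) = h u - 2 * ⟪u, c⟫_ℝ := by
    obtain ⟨x, hx, hxu⟩ := hatt u hu
    obtain ⟨y, hy, hyu⟩ := hatt (-u) hu'
    have h1 := hc x hx (-u) hu'
    have h2 := hc y hy u hu
    rw [inner_sub_right, inner_smul_right, inner_neg_left, inner_neg_left] at h1
    rw [inner_sub_right, inner_smul_right] at h2
    rw [inner_neg_left] at hyu
    linarith
  constructor
  · rintro ⟨hp, hpu⟩
    refine ⟨hc p hp, ?_⟩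
    rw [mem_ofPred_eq, inner_neg_left] at hpu
    rw [mem_ofPred_eq, inner_sub_right, inner_smul_right]
    linarith
  · rintro ⟨hp, hpu⟩
    refine ⟨by simpa using hc _ hp, ?_⟩
    rw [mem_ofPred_eq, inner_sub_right, inner_smul_right] at hpu
    rw [mem_ofPred_eq, inner_neg_left]
    linarith

omit [FiniteDimensional ℝ E] [MeasurableSpace E] [BorelSpace E] in
lemma mem_iff_of_image_eq {A : Set E} {c : E} (h : (fun y => (2 : ℝ) • c - y) '' A = A) (p : E) :
    (2 : ℝ) • c - p ∈ A ↔ p ∈ A := by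
  have key : ∀ q ∈ A, (2 : ℝ) • c - q ∈ A := fun q hq => by
    have := mem_image_of_mem (fun y => (2 : ℝ) • c - y) hq
    rwa [h] at this
  exact ⟨fun hp => by simpa using key _ hp, key p⟩

/-- The translates of a facet of `A` and of the opposite facet lying in a common hyperplane form
a signed tiling of this hyperplane. -/
lemma IsSignedTiling.facet {ι κ : Type*} [Countable ι] [IsEmpty κ] {N : Finset E}
    (hN : ∀ v ∈ N, ‖v‖ = 1) (hneg : ∀ v ∈ N, -v ∈ N) {h : E → ℝ} {x : ι → E}
    {y : κ → E} (ht : IsSignedTiling (polyhedron N h) x y) {c : E}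
    (hc : ∀ p ∈ polyhedron N h, (2 : ℝ) • c - p ∈ polyhedron N h)
    (hatt : ∀ v ∈ N, ∃ x ∈ polyhedron N h, ⟪v, x⟫_ℝ = h v) {u : E} (hu : u ∈ N)
    {w : E → ((ℝ ∙ u)ᗮ : Submodule ℝ E)} (hw : ∀ x, x = (w x : E) + ⟪u, x⟫_ℝ • u) (t : ℝ) :
    IsSignedTiling {z : ((ℝ ∙ u)ᗮ : Submodule ℝ E) | (z : E) + h u • u ∈ polyhedron N h}
      (fun i : {i // ⟪u, x i⟫_ℝ = t} => w (x i))
      (fun i : {i // ⟪u, x i⟫_ℝ = t + 2 * (h u - ⟪u, c⟫_ℝ)} => (2 : ℝ) • w c + w (x i)) := by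
  have hu1 := hN u hu
  set A : Set ((ℝ ∙ u)ᗮ : Submodule ℝ E) := {z | (z : E) + h u • u ∈ polyhedron N h}
  set r := h u + t
  have hA : ∀ z : ((ℝ ∙ u)ᗮ : Submodule ℝ E),
      z ∈ A ↔ (z : E) + h u • u ∈ polyhedronFace N h u := fun z =>
    ⟨fun hz => ⟨hz, inner_coe_add_smul hu1 z _⟩, fun hz => hz.1⟩
  have hinn : ∀ (i : ι) (z : ((ℝ ∙ u)ᗮ : Submodule ℝ E)),
      ⟪u, -x i +ᵥ ((z : E) + r • u)⟫_ℝ = r - ⟪u, x i⟫_ℝ := fun i z => by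
    rw [vadd_eq_add, inner_add_right, inner_neg_right, inner_coe_add_smul hu1]
    ring
  have hl : ∀ (i : {i // ⟪u, x i⟫_ℝ = t}) (z : ((ℝ ∙ u)ᗮ : Submodule ℝ E)),
      z ∈ w (x i) +ᵥ A ↔ (z : E) + r • u ∈ x i +ᵥ polyhedronFace N h u := by
    intro i z
    rw [mem_vadd_set_iff_neg_vadd_mem, mem_vadd_set_iff_neg_vadd_mem, hA]
    rw [iff_iff_eq]
    congr 1
    have := hw (x i)
    rw [i.2] at this
    conv_rhs => rw [this]
    simp only [vadd_eq_add, Submodule.coe_add, Submodule.coe_neg, r]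
    module
  have hr : ∀ (i : {i // ⟪u, x i⟫_ℝ = t + 2 * (h u - ⟪u, c⟫_ℝ)})
      (z : ((ℝ ∙ u)ᗮ : Submodule ℝ E)), z ∈ ((2 : ℝ) • w c + w (x i)) +ᵥ -A ↔
        (z : E) + r • u ∈ x i +ᵥ polyhedronFace N h (-u) := by
    intro i z
    rw [mem_vadd_set_iff_neg_vadd_mem, mem_vadd_set_iff_neg_vadd_mem, Set.mem_neg, hA,
      mem_polyhedronFace_neg_iff hu (hneg u hu) hc hatt]
    rw [iff_iff_eq]
    congr 1
    have h1 := hw (x i)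
    have h2 := hw c
    rw [i.2] at h1
    simp only [vadd_eq_add, Submodule.coe_add, Submodule.coe_neg, Submodule.coe_smul, r]
    linear_combination (norm := module) (-2 : ℝ) • h2 - h1
  have hcont : Continuous fun z : ((ℝ ∙ u)ᗮ : Submodule ℝ E) => (z : E) + r • u := by fun_prop
  have hface : ∀ (v : E) (i : ι), x i +ᵥ polyhedronFace N h v ⊆ x i +ᵥ polyhedron N h :=
    fun v i => vadd_set_mono inter_subset_left
  have hlf : ∀ (v : E), LocallyFinite fun i => (fun z : ((ℝ ∙ u)ᗮ : Submodule ℝ E) =>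
      (z : E) + r • u) ⁻¹' (x i +ᵥ polyhedronFace N h v) := fun v =>
    (ht.locallyFinite_left.subset (hface v)).preimage_continuous hcont
  obtain ⟨m, hm, -⟩ := ht.tsum_decayWeight
  have hsub : ∀ s : ι → Prop, ∑' i : {i // s i}, decayWeight m 1 (x i) ≠ ⊤ := fun s =>
    ne_top_of_le_ne_top hm (ENNReal.tsum_comp_le_tsum_of_injective Subtype.val_injective _)
  refine ⟨?_, ?_, ⟨0, by simp, ?_⟩, m, ?_, ?_⟩
  · exact ((hlf u).comp_injective Subtype.val_injective).subset fun i z => (hl i z).1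
  · exact ((hlf (-u)).comp_injective Subtype.val_injective).subset fun i z => (hr i z).1
  · filter_upwards [ht.coverCount_face_add_eq hN hneg hu r] with z hz
    have e0 : ∀ P : κ → Set E, coverCount P ((z : E) + r • u) = 0 := fun P => tsum_empty
    rw [e0, e0, add_zero, add_zero] at hz
    rw [zero_add, coverCount_congr (Q := fun i : {i // ⟪u, x i⟫_ℝ = t} =>
        x i +ᵥ polyhedronFace N h u) (fun i => hl i z),
      coverCount_congr (Q := fun i : {i // ⟪u, x i⟫_ℝ = t + 2 * (h u - ⟪u, c⟫_ℝ)} =>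
        x i +ᵥ polyhedronFace N h (-u)) (fun i => hr i z),
      coverCount_subtype (P := fun i => x i +ᵥ polyhedronFace N h u),
      coverCount_subtype (P := fun i => x i +ᵥ polyhedronFace N h (-u)), hz]
    · intro i hi
      rw [mem_vadd_set_iff_neg_vadd_mem, mem_polyhedronFace_neg_iff hu (hneg u hu) hc hatt] at hi
      have h1 : ⟪u, (2 : ℝ) • c - (-x i +ᵥ ((z : E) + r • u))⟫_ℝ = h u := hi.2
      rw [inner_sub_right, hinn, inner_smul_right] at h1
      simp only [r] at h1
      linarith
    · intro i hi
      rw [mem_vadd_set_iff_neg_vadd_mem] at hi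
      have h1 : ⟪u, -x i +ᵥ ((z : E) + r • u)⟫_ℝ = h u := hi.2
      rw [hinn] at h1
      simp only [r] at h1
      linarith
  · have e : ∀ i : {i // ⟪u, x i⟫_ℝ = t},
        decayWeight m 1 (w (x i)) = decayWeight m 1 (x i + -(t • u)) := by
      intro i
      have h1 := hw (x i)
      rw [i.2] at h1
      rw [decayWeight, decayWeight, ← Submodule.norm_coe, eq_add_neg_of_add_eq h1.symm]
    simp_rw [e]
    exact tsum_decayWeight_add_ne_top (hsub _) (fun _ => le_rfl) (norm_nonneg _)
  · have e : ∀ i : {i // ⟪u, x i⟫_ℝ = t + 2 * (h u - ⟪u, c⟫_ℝ)},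
        decayWeight m 1 ((2 : ℝ) • w c + w (x i)) = decayWeight m 1
          (x i + ((2 : ℝ) • (w c : E) - (t + 2 * (h u - ⟪u, c⟫_ℝ)) • u)) := by
      intro i
      have h1 := hw (x i)
      rw [i.2] at h1
      have h2 : ((((2 : ℝ) • w c + w (x i) : ((ℝ ∙ u)ᗮ : Submodule ℝ E))) : E) =
          x i + ((2 : ℝ) • (w c : E) - (t + 2 * (h u - ⟪u, c⟫_ℝ)) • u) := by
        rw [Submodule.coe_add, Submodule.coe_smul, eq_add_neg_of_add_eq h1.symm]
        abel
      rw [decayWeight, decayWeight, ← Submodule.norm_coe, h2]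
    simp_rw [e]
    exact tsum_decayWeight_add_ne_top (hsub _) (fun _ => le_rfl) (norm_nonneg _)

end

section

variable {E : Type*} [NormedAddCommGroup E] [InnerProductSpace ℝ E] [FiniteDimensional ℝ E]
    [MeasurableSpace E] [BorelSpace E]

/-- A multiple tiling by translates of a convex body is a signed tiling without negative part,
and its prototile is polyhedral. -/
lemma isPolyhedral_and_isSignedTiling {K : Set E} (hcpt : IsCompact K) (hconv : Convex ℝ K)
    (hint : (interior K).Nonempty) {k : ℕ} (hk : 0 < k) {ι : Type*} {x : ι → E}
    (hfin : ∀ B : Set E, Bornology.IsBounded B → {i | ((x i +ᵥ K) ∩ B).Nonempty}.Finite)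
    (hcount : ∀ p : E, (∀ i, p ∉ frontier (x i +ᵥ K)) → {i | p ∈ x i +ᵥ K}.encard = k) :
    Countable ι ∧ Nonempty ι ∧ IsPolyhedral K ∧
      IsSignedTiling K x (Empty.elim : Empty → E) := by
  have hloc : LocallyFinite fun i => x i +ᵥ K := fun p =>
    ⟨Metric.ball p 1, Metric.ball_mem_nhds p one_pos, hfin _ Metric.isBounded_ball⟩
  have hne : K.Nonempty := hint.mono interior_subset
  have hcountable : Countable ι := by
    rw [← countable_univ_iff]
    exact hloc.countable_univ fun i => hne.vadd_set
  have hae : ∀ᵐ p : E, coverCount (fun i => x i +ᵥ K) p = k := by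
    have : ∀ᵐ p : E, ∀ i, p ∉ frontier (x i +ᵥ K) :=
      ae_all_iff.2 fun i => measure_eq_zero_iff_ae_notMem.1
        ((hconv.vadd (x i)).addHaar_frontier volume)
    filter_upwards [this] with p hp
    rw [coverCount_eq_encard, hcount p hp]
    simp
  have hnon : Nonempty ι := by
    by_contra h
    rw [not_nonempty_iff] at h
    have := hcount 0 fun i => h.elim i
    rw [Set.eq_empty_of_isEmpty {i | (0 : E) ∈ x i +ᵥ K}, encard_empty] at this
    exact hk.ne (by exact_mod_cast this)
  obtain ⟨i₀⟩ := hnon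
  have hpoly : IsPolyhedral (x i₀ +ᵥ K) := by
    refine isPolyhedral_of_coverCount_eq (P := fun i => x i +ᵥ K) hloc
      (fun i => (hcpt.vadd (x i)).isClosed) (ENNReal.natCast_ne_top k)
      (Measure.dense_of_ae hae) (fun i => hconv.vadd (x i)) ?_ (hcpt.vadd (x i₀))
    rw [interior_vadd]
    exact hint.vadd_set
  have hpoly' := hpoly.vadd (-x i₀)
  rw [neg_vadd_vadd] at hpoly'
  exact ⟨hcountable, ⟨i₀⟩, hpoly', isSignedTiling_of_coverCount hcpt
    (Measure.measure_pos_of_nonempty_interior volume hint).ne' (ENNReal.natCast_ne_top k) hloc hae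
    Empty.elim⟩

omit [MeasurableSpace E] [BorelSpace E] in
/-- A supporting functional of a proper exposed face may be taken to be the inner product with a
unit vector. -/
lemma IsExposed.exists_inner_eq {K F : Set E} (hF : IsExposed ℝ K F) (hne : F.Nonempty)
    (hFK : F ≠ K) : ∃ u : E, ‖u‖ = 1 ∧ F = {x ∈ K | ∀ y ∈ K, ⟪u, y⟫_ℝ ≤ ⟪u, x⟫_ℝ} := by
  obtain ⟨l, hl⟩ := hF hne
  have hl0 : (InnerProductSpace.toDual ℝ E).symm l ≠ 0 := fun h0 => by
    rw [LinearIsometryEquiv.map_eq_zero_iff] at h0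
    subst h0
    exact hFK (by simpa using hl)
  set v := (InnerProductSpace.toDual ℝ E).symm l
  have hv : ∀ x, l x = ⟪v, x⟫_ℝ := fun x => (InnerProductSpace.toDual_symm_apply).symm
  refine ⟨‖v‖⁻¹ • v, norm_smul_inv_norm hl0, ?_⟩
  simp_rw [real_inner_smul_left, mul_le_mul_iff_right₀ (inv_pos.2 (norm_pos_iff.2 hl0)), ← hv]
  exact hl

/-- Every facet of the prototile of a multiple tiling is centrally symmetric. -/
lemma IsSignedTiling.exists_center_of_isExposed {ι κ : Type*} [Countable ι] [Nonempty ι]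
    [IsEmpty κ] {K : Set E} {x : ι → E} {y : κ → E} (ht : IsSignedTiling K x y)
    (hpoly : IsPolyhedral K) (hcpt : IsCompact K) (hconv : Convex ℝ K) {c : E}
    (hc : (fun y => (2 : ℝ) • c - y) '' K = K) {F : Set E} (hF : IsExposed ℝ K F)
    (hne : F.Nonempty) (hFK : F ≠ K)
    (hd : Module.finrank ℝ (affineSpan ℝ F).direction + 1 = Module.finrank ℝ E) :
    ∃ c, (fun y => (2 : ℝ) • c - y) '' F = F := by
  obtain ⟨u, hu1, hFu⟩ := hF.exists_inner_eq hne hFK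
  obtain ⟨N, h, hN, hneg, hTN, hatt, rfl⟩ := hpoly.exists_eq_polyhedron hcpt
    (hne.mono hF.subset) (T := {u}) (by simpa using hu1)
  have hu : u ∈ N := hTN (Finset.mem_singleton_self u)
  choose w hw using exists_eq_coe_add_inner_smul hu1
  obtain ⟨i₀⟩ := ‹Nonempty ι›
  have htil := ht.facet hN hneg (fun p hp => (mem_iff_of_image_eq hc p).2 hp) hatt hu hw
    ⟪u, x i₀⟫_ℝ
  set A : Set ((ℝ ∙ u)ᗮ : Submodule ℝ E) := {z | (z : E) + h u • u ∈ polyhedron N h}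
  have hface : ∀ p, p ∈ F ↔ p ∈ polyhedron N h ∧ ⟪u, p⟫_ℝ = h u := by
    intro p
    rw [hFu]
    refine and_congr_right fun hp => ⟨fun hmax => ?_, fun hp' y hy => (hy u hu).trans hp'.ge⟩
    obtain ⟨q, hq, hqu⟩ := hatt u hu
    exact (hp u hu).antisymm (hqu ▸ hmax q hq)
  have hFA : F = (fun z : ((ℝ ∙ u)ᗮ : Submodule ℝ E) => (z : E) + h u • u) '' A := by
    ext p
    rw [hface]
    constructor
    · rintro ⟨hp, hpu⟩
      have h1 := hw p
      rw [hpu] at h1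
      refine ⟨w p, ?_, h1.symm⟩
      change (w p : E) + h u • u ∈ polyhedron N h
      rwa [← h1]
    · rintro ⟨z, hz, rfl⟩
      exact ⟨hz, inner_coe_add_smul hu1 z _⟩
  have hcA : IsCompact A := by
    have hemb : IsClosedEmbedding fun z : ((ℝ ∙ u)ᗮ : Submodule ℝ E) => (z : E) + h u • u :=
      (Homeomorph.addRight (h u • u)).isClosedEmbedding.comp
        (Submodule.closed_of_finiteDimensional _).isClosedEmbedding_subtypeVal
    exact hemb.isCompact_preimage hcpt
  have hconvA : Convex ℝ A := by
    intro z hz z' hz' a b ha hb hab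
    have := hconv hz hz' ha hb hab
    change ((a • z + b • z' : ((ℝ ∙ u)ᗮ : Submodule ℝ E)) : E) + h u • u ∈ polyhedron N h
    convert this using 1
    rw [Submodule.coe_add, Submodule.coe_smul, Submodule.coe_smul]
    linear_combination (norm := module) (-hab) • (h u • u)
  have hneA : A.Nonempty := by
    rw [hFA] at hne
    exact hne.of_image
  have hiA : (interior A).Nonempty := by
    refine interior_nonempty_of_finrank_direction hconvA hneA (h u • u) ?_
    rw [← hFA]
    have := Submodule.finrank_add_finrank_orthogonal (ℝ ∙ u)
    rw [finrank_span_singleton (norm_ne_zero_iff.1 (hu1 ▸ one_ne_zero))] at this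
    omega
  have : Nonempty {i // ⟪u, x i⟫_ℝ = ⟪u, x i₀⟫_ℝ} := ⟨⟨i₀, rfl⟩⟩
  obtain ⟨d, hdA⟩ := htil.exists_center (hpoly.slice _ _) hcA hconvA hiA
  refine ⟨(d : E) + h u • u, ?_⟩
  rw [hFA, image_image]
  conv_rhs => rw [← hdA]
  rw [image_image]
  refine image_congr fun z _ => ?_
  rw [Submodule.coe_sub, Submodule.coe_smul]
  module

end

theorem stmt_15 {n : ℕ} (K : Set (EuclideanSpace ℝ (Fin n))) (hK : IsConvexBody K)
    (k : ℕ) (hk : 0 < k) (htile : IsKFoldTranslativeTile K k) :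
    IsPolytope K ∧ IsCentrallySymmetric K ∧
      ∀ F, IsFaceOfDim K F (n - 1) → IsCentrallySymmetric F := by
  obtain ⟨hcpt, hconv, hint⟩ := hK
  obtain ⟨ι, x, hfin, hcount⟩ := htile
  obtain ⟨_, _, hpoly, ht⟩ := isPolyhedral_and_isSignedTiling hcpt hconv hint hk hfin hcount
  obtain ⟨c, hc⟩ := ht.exists_center hpoly hcpt hconv hint
  refine ⟨hpoly.exists_eq_convexHull hcpt hconv, ⟨c, hc⟩, fun F ⟨hF, hne, hd⟩ => ?_⟩
  rcases n.eq_zero_or_pos with rfl | hn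
  · obtain ⟨q, hq⟩ := hne
    have hall : ∀ p, p ∈ F := fun p => Subsingleton.elim q p ▸ hq
    exact ⟨0, Set.ext fun p =>
      iff_of_true ⟨p, hall p, Subsingleton.elim _ _⟩ (hall p)⟩
  · refine ht.exists_center_of_isExposed hpoly hcpt hconv hc hF hne ?_ ?_
    · rintro rfl
      rw [hconv.interior_nonempty_iff_affineSpan_eq_top.1 hint, AffineSubspace.direction_top,
        finrank_top, finrank_euclideanSpace_fin] at hd
      omega
    · rw [hd, finrank_euclideanSpace_fin]
      omega
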